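/- Let 0 < α < 1 and N ≥ 0 an integer. For smooth mean-zero f, g: 𝕋² → ℝ define S[f,g] = Δ^{−1} div(𝒯[Δf] g + 𝒯[g] Δf), where 𝒯 = ∇^⊥Λ^{−1} and Δ^{−1} is the inverse Laplacian on mean-zero functions. Then ‖S[f,g]‖_{N+α} ≲ ‖f‖_{N+1+α}‖g‖_α + ‖f‖_{1+α}‖g‖_{N+α}, with implicit constant depending only on α and N. -/

import Mathlib

/-!
Common setup: functions on the torus `𝕋^d = ℝ^d/(2πℤ)^d` are modelled as
`2π`-periodic functions on `ℝ^d = Fin d → ℝ`, with Fourier coefficients,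
Fourier multiplier operators, Hölder norms, etc.
-/

noncomputable section

open scoped BigOperators
open MeasureTheory

/-- Points of `ℝ^d` (covering the torus `𝕋^d = ℝ^d/(2πℤ)^d`). -/
abbrev Vd (d : ℕ) := Fin d → ℝ

/-- The lattice vector `2π m`. -/
def latt {d : ℕ} (m : Fin d → ℤ) : Vd d := fun i => 2 * Real.pi * (m i : ℝ)

/-- `f` is `2π`-periodic in each coordinate, i.e. a function on the torus `𝕋^d`. -/
def TorusFun {d : ℕ} {F : Type*} (f : Vd d → F) : Prop :=
  ∀ (x : Vd d) (m : Fin d → ℤ), f (x + latt m) = f x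

/-- Dot product of an integer frequency with a point of `ℝ^d`. -/
def dotZ {d : ℕ} (k : Fin d → ℤ) (x : Vd d) : ℝ := ∑ i, (k i : ℝ) * x i

/-- The Euclidean norm on `ℝ^d`. -/
def eNorm {d : ℕ} (x : Vd d) : ℝ := Real.sqrt (∑ i, (x i) ^ 2)

/-- `|k|` for an integer frequency `k ∈ ℤ^d`. -/
def kAbs {d : ℕ} (k : Fin d → ℤ) : ℝ := eNorm (fun i => (k i : ℝ))

/-- The fundamental domain `[0,2π]^d`. -/
def box (d : ℕ) : Set (Vd d) := Set.Icc 0 (fun _ => 2 * Real.pi)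

/-- Mean-zero (real-valued) function on the torus. -/
def MeanZeroR {d : ℕ} (f : Vd d → ℝ) : Prop := ∫ x in box d, f x = 0

/-- Fourier coefficient `f̂(k)` of a function on the torus. -/
def fCoeff {d : ℕ} (f : Vd d → ℂ) (k : Fin d → ℤ) : ℂ :=
  (((2 * Real.pi) ^ d)⁻¹ : ℝ) • ∫ x in box d, f x * Complex.exp (-(Complex.I * (dotZ k x : ℂ)))

/-- Fourier multiplier operator with symbol `m : ℤ^d → ℂ`. -/
def fmul {d : ℕ} (m : (Fin d → ℤ) → ℂ) (f : Vd d → ℂ) : Vd d → ℂ :=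
  fun x => ∑' k : Fin d → ℤ, m k * fCoeff f k * Complex.exp (Complex.I * (dotZ k x : ℂ))

/-- `Λ^s = (-Δ)^{s/2}`: Fourier multiplier with symbol `|k|^s` (acting on mean-zero parts). -/
def LamPow {d : ℕ} (s : ℝ) : (Vd d → ℂ) → Vd d → ℂ :=
  fmul (fun k => if k = 0 then 0 else (((kAbs k) ^ s : ℝ) : ℂ))

/-- `Λ = (-Δ)^{1/2}`. -/
def Lam1 {d : ℕ} : (Vd d → ℂ) → Vd d → ℂ := LamPow 1

/-- `i`-th component of the SQG operator `∇^⊥Λ^{-1} = (-∂₂Λ^{-1}, ∂₁Λ^{-1})`,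
with symbols `(-i k₂/|k|, i k₁/|k|)`. -/
def sqgOp (i : Fin 2) : (Vd 2 → ℂ) → Vd 2 → ℂ :=
  fmul (fun k => if k = 0 then 0 else
    (if i = 0 then -(Complex.I * (k 1 : ℂ)) else Complex.I * (k 0 : ℂ)) / ((kAbs k : ℝ) : ℂ))

/-- First-order partial derivative `∂_i`. -/
def pd {d : ℕ} {F : Type*} [NormedAddCommGroup F] [NormedSpace ℝ F]
    (i : Fin d) (f : Vd d → F) (x : Vd d) : F :=
  fderiv ℝ f x (Pi.single i 1)

/-- Complexification of a real-valued function. -/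
def cplx {d : ℕ} (f : Vd d → ℝ) : Vd d → ℂ := fun x => (f x : ℂ)

/-- The `C^N` norm: sum of sup-norms of the iterated derivatives of order `≤ N`. -/
def CkNorm {d : ℕ} {F : Type*} [NormedAddCommGroup F] [NormedSpace ℝ F]
    (N : ℕ) (f : Vd d → F) : ℝ :=
  ∑ n ∈ Finset.range (N + 1), ⨆ x : Vd d, ‖iteratedFDeriv ℝ n f x‖

/-- The `α`-Hölder seminorm. -/
def hSemi {d : ℕ} {F : Type*} [NormedAddCommGroup F] (α : ℝ) (f : Vd d → F) : ℝ :=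
  ⨆ p : Vd d × Vd d, if p.1 = p.2 then 0 else ‖f p.1 - f p.2‖ / ‖p.1 - p.2‖ ^ α

/-- The `C^{N,α}` Hölder norm `‖f‖_{N+α}`. -/
def HolNorm {d : ℕ} {F : Type*} [NormedAddCommGroup F] [NormedSpace ℝ F]
    (N : ℕ) (α : ℝ) (f : Vd d → F) : ℝ :=
  CkNorm N f + hSemi α (iteratedFDeriv ℝ N f)

/-- `∇^⊥·div R` for a `2`-tensor field `R` on `ℝ²` (values in any normed space). -/
def perpDivDiv {F : Type*} [NormedAddCommGroup F] [NormedSpace ℝ F]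
    (R : Vd 2 → Fin 2 → Fin 2 → F) (x : Vd 2) : F :=
  - pd 1 (fun y => ∑ j, pd j (fun z => R z 0 j) y) x
  + pd 0 (fun y => ∑ j, pd j (fun z => R z 1 j) y) x

/-- Material derivative `D_t f = ∂_t f + u·∇f`. -/
def matD (u : ℝ → Vd 2 → Fin 2 → ℝ) (f : ℝ → Vd 2 → ℝ) (t : ℝ) (x : Vd 2) : ℝ :=
  deriv (fun s => f s x) t + ∑ i, u t x i * pd i (f t) x

/-- The SQG–Reynolds system `∂_tθ + u·∇θ = ∇^⊥·div R`, `u = ∇^⊥Λ^{-1}θ`,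
for smooth space-periodic data with `R` symmetric. -/
structure SQGReynolds (θ : ℝ → Vd 2 → ℝ) (u : ℝ → Vd 2 → Fin 2 → ℝ)
    (R : ℝ → Vd 2 → Fin 2 → Fin 2 → ℝ) : Prop where
  smooth_θ : ContDiff ℝ (⊤ : ℕ∞) fun p : ℝ × Vd 2 => θ p.1 p.2
  smooth_u : ContDiff ℝ (⊤ : ℕ∞) fun p : ℝ × Vd 2 => u p.1 p.2
  smooth_R : ContDiff ℝ (⊤ : ℕ∞) fun p : ℝ × Vd 2 => R p.1 p.2
  periodic_θ : ∀ t, TorusFun (θ t)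
  periodic_u : ∀ t, TorusFun (u t)
  periodic_R : ∀ t, TorusFun (R t)
  symm_R : ∀ t x i j, R t x i j = R t x j i
  vel : ∀ t x i, (u t x i : ℂ) = sqgOp i (cplx (θ t)) x
  eqn : ∀ t x, matD u θ t x = perpDivDiv (R t) x

/-- The bilinear operator `T[f,g] = Λ^{-1}((Λf)g - f(Λg))`. -/
def Tbil (f g : Vd 2 → ℂ) : Vd 2 → ℂ :=
  LamPow (-1) (fun x => Lam1 f x * g x - f x * Lam1 g x)

/-- A Littlewood–Paley bump: smooth, spherically symmetric, `ψ = 1` on `B₁(0)`,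
`supp ψ ⊂ B_{3/2}(0)`. -/
structure LPfun {d : ℕ} (ψ : Vd d → ℝ) : Prop where
  smooth : ContDiff ℝ (⊤ : ℕ∞) ψ
  radial : ∀ x y : Vd d, eNorm x = eNorm y → ψ x = ψ y
  supp : ∀ x, 3/2 ≤ eNorm x → ψ x = 0
  one : ∀ x, eNorm x ≤ 1 → ψ x = 1

/-- Littlewood–Paley block `Δ_j f` (with `Δ_{-1}f = f̂(0)`, `Δ_j f = 0` for `j < -1`). -/
def LPblock {d : ℕ} (ψ : Vd d → ℝ) (j : ℤ) (f : Vd d → ℂ) : Vd d → ℂ :=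
  if j < -1 then 0
  else if j = -1 then fun _ => fCoeff f 0
  else fun x => ∑' k : Fin d → ℤ,
    (((ψ (fun i => (k i : ℝ) / 2 ^ j) - ψ (fun i => (k i : ℝ) / 2 ^ (j - 1))) : ℝ) : ℂ)
      * fCoeff f k * Complex.exp (Complex.I * (dotZ k x : ℂ))

/-- Low-frequency projection `S_j f = Σ_{i ≤ j} Δ_i f`. -/
def LPlow {d : ℕ} (ψ : Vd d → ℝ) (j : ℤ) (f : Vd d → ℂ) : Vd d → ℂ :=
  if j < -1 then 0
  else if j = -1 then fun _ => fCoeff f 0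
  else fun x => ∑' k : Fin d → ℤ,
    ((ψ (fun i => (k i : ℝ) / 2 ^ j) : ℝ) : ℂ)
      * fCoeff f k * Complex.exp (Complex.I * (dotZ k x : ℂ))

/-- Laplacian (computed from derivatives). -/
def lapC (f : Vd 2 → ℂ) (x : Vd 2) : ℂ := ∑ i, pd i (fun y => pd i f y) x

/-- Divergence of a vector field. -/
def divC (v : Vd 2 → Fin 2 → ℂ) (x : Vd 2) : ℂ := ∑ i, pd i (fun y => v y i) x

/-- Inverse Laplacian on mean-zero functions: symbol `-1/|k|²`. -/
def LapInv : (Vd 2 → ℂ) → Vd 2 → ℂ :=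
  fmul (fun k => if k = 0 then 0 else -((((kAbs k) ^ 2 : ℝ) : ℂ))⁻¹)

/-- `S[f,g] = Δ^{-1} div(𝒯[Δf] g + 𝒯[g] Δf)` with `𝒯 = ∇^⊥Λ^{-1}`. -/
def Sbil (f g : Vd 2 → ℂ) : Vd 2 → ℂ :=
  LapInv (fun x =>
    divC (fun y i => sqgOp i (fun z => lapC f z) y * g y + sqgOp i g y * lapC f y) x)

/-- Polynomial frequency weight. -/
def om (k : Fin 2 → ℤ) : ℝ := 1 + ‖k‖

lemma one_le_om (k : Fin 2 → ℤ) : 1 ≤ om k := by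
  unfold om; linarith [norm_nonneg k]

lemma om_pos (k : Fin 2 → ℤ) : 0 < om k := lt_of_lt_of_le one_pos (one_le_om k)

lemma abs_coord_le_om (k : Fin 2 → ℤ) (i : Fin 2) : |(k i : ℝ)| ≤ om k := by
  have h := norm_le_pi_norm k i
  rw [Int.norm_eq_abs] at h
  unfold om; linarith

lemma om_add_le (k l : Fin 2 → ℤ) : om (k + l) ≤ om k * om l := by
  unfold om
  nlinarith [norm_add_le k l, norm_nonneg k, norm_nonneg l]

/-- Rapidly decaying coefficient families. -/
def RD (c : (Fin 2 → ℤ) → ℂ) : Prop := ∀ n : ℕ, Summable fun k => om k ^ n * ‖c k‖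

lemma RD.summable_norm {c : (Fin 2 → ℤ) → ℂ} (h : RD c) : Summable fun k => ‖c k‖ := by
  simpa using h 0

lemma RD.mul_of_bound {c m : (Fin 2 → ℤ) → ℂ} (h : RD c) (C : ℝ) (p : ℕ)
    (hm : ∀ k, ‖m k‖ ≤ C * om k ^ p) : RD fun k => m k * c k := by
  intro n
  refine Summable.of_nonneg_of_le (fun k => ?_) (fun k => ?_) ((h (n + p)).mul_left C)
  · have := om_pos k; positivity
  · have h1 := om_pos k
    rw [norm_mul]
    calc om k ^ n * (‖m k‖ * ‖c k‖) ≤ om k ^ n * ((C * om k ^ p) * ‖c k‖) := by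
          gcongr; exact hm k
      _ = C * (om k ^ (n + p) * ‖c k‖) := by ring

lemma RD.add {c d : (Fin 2 → ℤ) → ℂ} (hc : RD c) (hd : RD d) : RD fun k => c k + d k := by
  intro n
  refine Summable.of_nonneg_of_le (fun k => ?_) (fun k => ?_) ((hc n).add (hd n))
  · have := om_pos k; positivity
  · rw [← mul_add]
    have := om_pos k
    gcongr
    exact norm_add_le _ _

lemma summable_om_inv : Summable fun k : Fin 2 → ℤ => (om k ^ 3)⁻¹ := by
  have h := EisensteinSeries.summable_one_div_norm_rpow (k := 3) (by norm_num)
  have h2 : Summable fun k : Fin 2 → ℤ => ‖k‖ ^ (-3 : ℝ) + (if k = 0 then 1 else 0 : ℝ) := by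
    refine h.add ?_
    exact summable_of_ne_finset_zero (s := {0}) (by intro b hb; simp at hb; simp [hb])
  refine Summable.of_nonneg_of_le (fun k => ?_) (fun k => ?_) h2
  · have := om_pos k; positivity
  · by_cases hk : k = 0
    · subst hk
      simp [om]
    · have hk' : 0 < ‖k‖ := norm_pos_iff.2 hk
      simp only [hk, if_false, add_zero]
      rw [Real.rpow_neg (norm_nonneg k)]
      gcongr
      have : ‖k‖ ^ (3:ℝ) = ‖k‖ ^ (3:ℕ) := by exact_mod_cast Real.rpow_natCast ‖k‖ 3
      rw [this]
      gcongr
      unfold om; linarith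

lemma RD.of_bound {c : (Fin 2 → ℤ) → ℂ} (h : ∀ n : ℕ, ∃ C, ∀ k, om k ^ n * ‖c k‖ ≤ C) :
    RD c := by
  intro n
  obtain ⟨C, hC⟩ := h (n + 3)
  refine Summable.of_nonneg_of_le (fun k => ?_) (fun k => ?_) (summable_om_inv.mul_left C)
  · have := om_pos k; positivity
  · have h1 := om_pos k
    rw [← div_eq_mul_inv, le_div_iff₀ (by positivity)]
    calc _ = om k ^ (n + 3) * ‖c k‖ := by ring
      _ ≤ C := hC k

/-- The character `x ↦ exp(i k·x)`. -/
def ee (k : Fin 2 → ℤ) (x : Vd 2) : ℂ := Complex.exp (Complex.I * (dotZ k x : ℂ))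

lemma norm_ee (k : Fin 2 → ℤ) (x : Vd 2) : ‖ee k x‖ = 1 := by
  unfold ee; rw [mul_comm]; exact Complex.norm_exp_ofReal_mul_I _

lemma dotZ_two (k : Fin 2 → ℤ) (x : Vd 2) : dotZ k x = k 0 * x 0 + k 1 * x 1 := by
  simp [dotZ, Fin.sum_univ_two]

lemma ee_add_left (k l : Fin 2 → ℤ) (x : Vd 2) : ee (k + l) x = ee k x * ee l x := by
  unfold ee
  rw [← Complex.exp_add, dotZ_two, dotZ_two, dotZ_two]
  congr 1
  push_cast [Pi.add_apply]
  ring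

lemma ee_add_right (k : Fin 2 → ℤ) (x y : Vd 2) : ee k (x + y) = ee k x * ee k y := by
  unfold ee
  rw [← Complex.exp_add, dotZ_two, dotZ_two, dotZ_two]
  congr 1
  push_cast [Pi.add_apply]
  ring

lemma ee_latt (k : Fin 2 → ℤ) (m : Fin 2 → ℤ) : ee k (latt m) = 1 := by
  unfold ee
  rw [Complex.exp_eq_one_iff]
  refine ⟨k 0 * m 0 + k 1 * m 1, ?_⟩
  rw [dotZ_two]
  simp only [latt]
  push_cast
  ring

/-- The continuous linear functional `x ↦ k·x`. -/
def dotL (k : Fin 2 → ℤ) : Vd 2 →L[ℝ] ℝ :=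
  (k 0 : ℝ) • ContinuousLinearMap.proj 0 + (k 1 : ℝ) • ContinuousLinearMap.proj 1

lemma dotL_apply (k : Fin 2 → ℤ) (x : Vd 2) : dotL k x = dotZ k x := by
  simp [dotL, dotZ_two]

lemma dotZ_le (k : Fin 2 → ℤ) (x : Vd 2) : |dotZ k x| ≤ 2 * om k * ‖x‖ := by
  rw [dotZ_two]
  have h0 := norm_le_pi_norm x 0
  have h1 := norm_le_pi_norm x 1
  rw [Real.norm_eq_abs] at h0 h1
  calc _ ≤ |(k 0 : ℝ) * x 0| + |(k 1 : ℝ) * x 1| := abs_add_le _ _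
    _ = |(k 0 : ℝ)| * |x 0| + |(k 1 : ℝ)| * |x 1| := by rw [abs_mul, abs_mul]
    _ ≤ om k * ‖x‖ + om k * ‖x‖ := by
        have := om_pos k
        gcongr <;> exact abs_coord_le_om k _
    _ = _ := by ring

lemma norm_dotL_le (k : Fin 2 → ℤ) : ‖dotL k‖ ≤ 2 * om k := by
  refine ContinuousLinearMap.opNorm_le_bound _ (by have := om_pos k; positivity) fun x => ?_
  rw [dotL_apply]; exact dotZ_le k x

lemma hasFDerivAt_ee (k : Fin 2 → ℤ) (x : Vd 2) :
    HasFDerivAt (ee k) ((Complex.I * ee k x) • (Complex.ofRealCLM.comp (dotL k))) x := by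
  have h1 : HasFDerivAt (fun x : Vd 2 => Complex.I * ((dotL k x : ℝ) : ℂ))
      (Complex.I • (Complex.ofRealCLM.comp (dotL k))) x := by
    exact ((Complex.ofRealCLM.comp (dotL k)).hasFDerivAt).const_mul Complex.I
  have h2 := h1.cexp
  have h3 : (fun x : Vd 2 => Complex.exp (Complex.I * ((dotL k x : ℝ) : ℂ))) = ee k := by
    funext y; rw [dotL_apply]; rfl
  rw [h3] at h2
  refine h2.congr_fderiv ?_
  rw [smul_smul, dotL_apply, mul_comm]; rfl

/-- The trigonometric series with coefficients `c`. -/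
def EE (c : (Fin 2 → ℤ) → ℂ) (x : Vd 2) : ℂ := ∑' k, c k * ee k x

/-- Coefficients of the derivative `∂_i`. -/
def dC (i : Fin 2) (c : (Fin 2 → ℤ) → ℂ) : (Fin 2 → ℤ) → ℂ := fun k => Complex.I * (k i : ℂ) * c k

lemma RD.dC {c : (Fin 2 → ℤ) → ℂ} (h : RD c) (i : Fin 2) : RD (dC i c) := by
  refine RD.mul_of_bound (m := fun k => Complex.I * (k i : ℂ)) h 1 1 fun k => ?_
  have := abs_coord_le_om k i
  simpa using this

lemma RD.summable {c : (Fin 2 → ℤ) → ℂ} (h : RD c) (x : Vd 2) :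
    Summable fun k => c k * ee k x := by
  refine Summable.of_norm ?_
  simpa [norm_mul, norm_ee] using h.summable_norm

lemma EE_latt (c : (Fin 2 → ℤ) → ℂ) : TorusFun (EE c) := by
  intro x m
  simp [EE, ee_add_right, ee_latt]

lemma norm_EE_le {c : (Fin 2 → ℤ) → ℂ} (h : RD c) (x : Vd 2) : ‖EE c x‖ ≤ ∑' k, ‖c k‖ := by
  refine (norm_tsum_le_tsum_norm ?_).trans (le_of_eq ?_)
  · simpa [norm_mul, norm_ee] using h.summable_norm
  · simp [norm_ee]

lemma hasFDerivAt_EE {c : (Fin 2 → ℤ) → ℂ} (h : RD c) (x : Vd 2) :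
    HasFDerivAt (EE c) (∑ i, (ContinuousLinearMap.proj (R := ℝ) (φ := fun _ : Fin 2 => ℝ) i).smulRight
      (EE (dC i c) x)) x := by
  have key : HasFDerivAt (EE c) (∑' k, c k • ((Complex.I * ee k x) •
      (Complex.ofRealCLM.comp (dotL k)))) x := by
    refine hasFDerivAt_tsum (u := fun k => 2 * (om k ^ 1 * ‖c k‖)) ((h 1).mul_left 2)
      (f := fun k x => c k * ee k x)
      (f' := fun k x => c k • ((Complex.I * ee k x) • (Complex.ofRealCLM.comp (dotL k))))
      (fun k y => (hasFDerivAt_ee k y).const_mul (c k)) (fun k y => ?_) (x₀ := 0) (h.summable 0) x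
    rw [norm_smul, norm_smul, norm_mul, norm_ee]
    have h1 : ‖Complex.ofRealCLM.comp (dotL k)‖ ≤ 2 * om k := by
      refine (ContinuousLinearMap.opNorm_comp_le _ _).trans ?_
      rw [Complex.ofRealCLM_norm, one_mul]; exact norm_dotL_le k
    simp only [Complex.norm_I, mul_one, one_mul]
    nlinarith [norm_nonneg (c k)]
  refine key.congr_fderiv ?_
  have e1 : ∀ k, c k • ((Complex.I * ee k x) • (Complex.ofRealCLM.comp (dotL k))) =
      ∑ i, (ContinuousLinearMap.proj (R := ℝ) (φ := fun _ : Fin 2 => ℝ) i).smulRight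
        (dC i c k * ee k x) := by
    intro k
    ext v
    simp [dC, Fin.sum_univ_two, dotL_apply, dotZ_two]
    ring
  have hs : ∀ i, HasSum (fun k => (ContinuousLinearMap.proj (R := ℝ) (φ := fun _ : Fin 2 => ℝ) i).smulRight
        (dC i c k * ee k x)) ((ContinuousLinearMap.proj (R := ℝ) (φ := fun _ : Fin 2 => ℝ) i).smulRight
      (EE (dC i c) x)) := by
    intro i
    have := ((h.dC i).summable x).hasSum
    exact this.mapL (ContinuousLinearMap.smulRightL ℝ (Vd 2) ℂ (ContinuousLinearMap.proj i))
  have := hasSum_sum (s := Finset.univ) (fun i _ => hs i)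
  rw [funext e1]
  exact this.tsum_eq

lemma pd_EE {c : (Fin 2 → ℤ) → ℂ} (h : RD c) (i : Fin 2) : pd i (EE c) = EE (dC i c) := by
  funext x
  unfold pd
  rw [(hasFDerivAt_EE h x).fderiv]
  simp only [Fin.sum_univ_two]
  revert i
  simp [Fin.forall_fin_two]

lemma contDiff_EE {c : (Fin 2 → ℤ) → ℂ} (h : RD c) (n : ℕ) : ContDiff ℝ n (EE c) := by
  induction n generalizing c with
  | zero =>
    exact contDiff_zero.2 (continuous_iff_continuousAt.2 fun x => (hasFDerivAt_EE h x).continuousAt)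
  | succ n ih =>
    refine contDiff_succ_iff_hasFDerivAt.2 ⟨_, ?_, fun x => hasFDerivAt_EE h x⟩
    refine ContDiff.sum fun i _ => ?_
    exact (ContinuousLinearMap.smulRightL ℝ (Vd 2) ℂ (ContinuousLinearMap.proj i)).contDiff.comp
      (ih (h.dC i))

lemma latt_single (i : Fin 2) : latt (Pi.single i (1 : ℤ)) = Pi.single i (2 * Real.pi) := by
  funext j
  by_cases h : j = i
  · subst h; simp [latt]
  · simp [latt, h]

lemma volume_box : volume (box 2) = ENNReal.ofReal ((2 * Real.pi) ^ 2) := by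
  have hp := Real.pi_pos
  rw [box, Real.volume_Icc_pi]
  simp only [Pi.zero_apply, sub_zero, Finset.prod_const, Finset.card_univ, Fintype.card_fin]
  rw [ENNReal.ofReal_pow (by positivity)]

lemma isCompact_box : IsCompact (box 2) := isCompact_Icc

lemma integral_box_pd_eq_zero {h : Vd 2 → ℂ} (hs : ContDiff ℝ 1 h) (hp : TorusFun h) (i : Fin 2) :
    ∫ x in box 2, pd i h x = 0 := by
  have hpi := Real.pi_pos
  have hd : Differentiable ℝ h := hs.differentiable (by norm_num)
  have hc : Continuous (fderiv ℝ h) := hs.continuous_fderiv (by norm_num)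
  have key := integral_divergence_of_hasFDerivAt_off_countable' (n := 1) (0 : Vd 2)
    (fun _ => 2 * Real.pi) (fun _ => by simp; positivity)
    (fun j => if j = i then h else 0) (fun j => if j = i then fderiv ℝ h else 0)
    ∅ Set.countable_empty
    (fun j => by
      by_cases hj : j = i
      · simpa [hj] using hd.continuous.continuousOn
      · simp only [hj, if_false]; exact (continuous_const (y := (0 : ℂ))).continuousOn)
    (fun x _ j => by
      by_cases hj : j = i
      · simpa [hj] using (hd x).hasFDerivAt
      · simp only [hj, if_false]; exact hasFDerivAt_const (0 : ℂ) x)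
    (by
      refine Continuous.integrableOn_Icc ?_
      refine continuous_finsetSum _ fun j _ => ?_
      by_cases hj : j = i
      · simp only [hj, if_true]; exact hc.clm_apply continuous_const
      · simp only [hj, if_false]; exact continuous_const)
  have e1 : ∀ x : Vd 2, ∑ j, (if j = i then fderiv ℝ h else 0) x (Pi.single j 1) = pd i h x := by
    intro x
    rw [Finset.sum_eq_single i]
    · simp [pd]
    · intro j _ hj; simp [hj]
    · simp
  simp only [e1] at key
  unfold box
  rw [key, Finset.sum_eq_single i]
  · simp only [if_true]
    rw [sub_eq_zero]
    congr 1
    funext x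
    have : (Fin.insertNth i (2 * Real.pi) x : Vd 2)
        = Fin.insertNth i ((0 : Vd 2) i) x + latt (Pi.single i (1 : ℤ)) := by
      rw [latt_single]
      funext j
      refine Fin.succAboveCases i ?_ (fun j => ?_) j
      · simp
      · simp
    rw [this, hp]
  · intro j _ hj; simp [hj]
  · simp

lemma contDiff_ee (k : Fin 2 → ℤ) {n : WithTop ℕ∞} : ContDiff ℝ n (ee k) := by
  have h3 : (fun x : Vd 2 => Complex.exp (Complex.I * ((dotL k x : ℝ) : ℂ))) = ee k := by
    funext y; rw [dotL_apply]; rfl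
  rw [← h3]
  exact (contDiff_const.mul (Complex.ofRealCLM.contDiff.comp (dotL k).contDiff)).cexp

lemma continuous_ee (k : Fin 2 → ℤ) : Continuous (ee k) := (contDiff_ee k (n := 0)).continuous

lemma pd_ee (k : Fin 2 → ℤ) (i : Fin 2) (x : Vd 2) : pd i (ee k) x = Complex.I * k i * ee k x := by
  unfold pd
  rw [(hasFDerivAt_ee k x).fderiv]
  revert i
  simp [Fin.forall_fin_two, dotL_apply, dotZ_two]
  constructor <;> ring

lemma torusFun_ee (k : Fin 2 → ℤ) : TorusFun (ee k) := by
  intro x m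
  rw [ee_add_right, ee_latt, mul_one]

lemma ee_neg (k : Fin 2 → ℤ) (x : Vd 2) : ee (-k) x = Complex.exp (-(Complex.I * (dotZ k x : ℂ))) := by
  unfold ee
  rw [dotZ_two, dotZ_two]
  congr 1
  push_cast [Pi.neg_apply]
  ring

lemma fCoeff_eq (f : Vd 2 → ℂ) (k : Fin 2 → ℤ) :
    fCoeff f k = (((2 * Real.pi) ^ 2)⁻¹ : ℝ) • ∫ x in box 2, f x * ee (-k) x := by
  simp [fCoeff, ee_neg]

lemma ee_zero (x : Vd 2) : ee 0 x = 1 := by simp [ee, dotZ]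

lemma integral_box_ee (k : Fin 2 → ℤ) :
    ∫ x in box 2, ee k x = if k = 0 then (((2 * Real.pi) ^ 2 : ℝ) : ℂ) else 0 := by
  by_cases hk : k = 0
  · subst hk
    simp only [ee_zero, if_true]
    rw [setIntegral_const, Measure.real, volume_box, ENNReal.toReal_ofReal (by positivity)]
    simp
  · rw [if_neg hk]
    obtain ⟨i, hi⟩ : ∃ i, k i ≠ 0 := by
      by_contra! h; exact hk (funext h)
    have h := integral_box_pd_eq_zero (contDiff_ee k) (torusFun_ee k) i
    simp only [pd_ee] at h
    rw [integral_const_mul] at h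
    have : Complex.I * (k i : ℂ) ≠ 0 := mul_ne_zero Complex.I_ne_zero (by exact_mod_cast hi)
    exact (mul_eq_zero.1 h).resolve_left this

lemma fCoeff_EE {c : (Fin 2 → ℤ) → ℂ} (h : RD c) : fCoeff (EE c) = c := by
  funext k
  have hpi := Real.pi_pos
  rw [fCoeff_eq]
  have hs : HasSum (fun l => ∫ x in box 2, c l * ee l x * ee (-k) x)
      (∫ x in box 2, ∑' l, c l * ee l x * ee (-k) x) := by
    refine hasSum_integral_of_summable_integral_norm (fun l => ?_) ?_
    · exact Continuous.integrableOn_Icc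
        ((continuous_const.mul (continuous_ee l)).mul (continuous_ee (-k)))
    · simp only [norm_mul, norm_ee, mul_one]
      simp only [setIntegral_const, smul_eq_mul]
      exact h.summable_norm.mul_left _
  have e1 : ∀ x, EE c x * ee (-k) x = ∑' l, c l * ee l x * ee (-k) x := by
    intro x; rw [tsum_mul_right]; rfl
  simp only [e1]
  rw [← hs.tsum_eq]
  have e2 : ∀ l, ∫ x in box 2, c l * ee l x * ee (-k) x =
      if l = k then c l * (((2 * Real.pi) ^ 2 : ℝ) : ℂ) else 0 := by
    intro l
    simp only [mul_assoc, ← ee_add_left]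
    rw [integral_const_mul, integral_box_ee]
    by_cases hl : l = k
    · simp [hl]
    · have : l + -k ≠ 0 := by
        intro h0; exact hl (by rwa [add_neg_eq_zero] at h0)
      simp [hl, this]
  simp only [e2]
  rw [tsum_ite_eq k (fun l => c l * (((2 * Real.pi) ^ 2 : ℝ) : ℂ))]
  rw [Complex.real_smul]
  push_cast
  field_simp

lemma pd_mul {f g : Vd 2 → ℂ} (hf : Differentiable ℝ f) (hg : Differentiable ℝ g) (i : Fin 2)
    (x : Vd 2) : pd i (fun y => f y * g y) x = pd i f x * g x + f x * pd i g x := by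
  unfold pd
  rw [((hf x).hasFDerivAt.fun_mul (hg x).hasFDerivAt).fderiv]
  simp
  ring

lemma fCoeff_pd {f : Vd 2 → ℂ} (hf : ContDiff ℝ 1 f) (hp : TorusFun f) (i : Fin 2)
    (k : Fin 2 → ℤ) : fCoeff (pd i f) k = Complex.I * k i * fCoeff f k := by
  have h := integral_box_pd_eq_zero (h := fun x => f x * ee (-k) x)
    (hf.mul (contDiff_ee _)) (fun x m => by simp only [hp x m, torusFun_ee (-k) x m]) i
  have hd := hf.differentiable (by norm_num)
  have hc : Continuous (fderiv ℝ f) := hf.continuous_fderiv (by norm_num)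
  simp only [pd_mul hd ((contDiff_ee (-k) (n := 1)).differentiable (by norm_num)), pd_ee] at h
  have i1 : IntegrableOn (fun x => pd i f x * ee (-k) x) (box 2) :=
    Continuous.integrableOn_Icc ((hc.clm_apply continuous_const).mul (continuous_ee _))
  have i2 : IntegrableOn (fun x => f x * (Complex.I * ((-k) i : ℤ) * ee (-k) x)) (box 2) :=
    Continuous.integrableOn_Icc (hd.continuous.mul (continuous_const.mul (continuous_ee _)))
  rw [integral_add i1 i2] at h
  rw [fCoeff_eq, fCoeff_eq, eq_neg_of_add_eq_zero_left h, ← integral_neg, mul_smul_comm,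
    ← integral_const_mul]
  congr 2
  funext x
  push_cast [Pi.neg_apply]
  ring

lemma contDiff_pd {f : Vd 2 → ℂ} (hf : ContDiff ℝ (⊤ : ℕ∞) f) (i : Fin 2) :
    ContDiff ℝ (⊤ : ℕ∞) (pd i f) := by
  have h : ContDiff ℝ (⊤ : ℕ∞) (fderiv ℝ f) := hf.fderiv_right (by exact_mod_cast le_top)
  exact h.clm_apply contDiff_const

lemma torusFun_pd {f : Vd 2 → ℂ} (hp : TorusFun f) (i : Fin 2) : TorusFun (pd i f) := by
  intro x m
  unfold pd
  have : (fun y => f (y + latt m)) = f := funext fun y => hp y m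
  rw [← fderiv_comp_add_right, this]

lemma om_mul_norm_le (k : Fin 2 → ℤ) (z : ℂ) :
    om k * ‖z‖ ≤ ‖z‖ + ‖Complex.I * k 0 * z‖ + ‖Complex.I * k 1 * z‖ := by
  have : ‖k‖ ≤ |(k 0 : ℝ)| + |(k 1 : ℝ)| := by
    refine (pi_norm_le_iff_of_nonneg (by positivity)).2 ?_
    simp [Fin.forall_fin_two, Int.norm_eq_abs]
  unfold om
  simp only [norm_mul, Complex.norm_I, one_mul, Complex.norm_intCast]
  nlinarith [norm_nonneg z]

lemma fCoeff_decay (n : ℕ) {f : Vd 2 → ℂ} (hf : ContDiff ℝ (⊤ : ℕ∞) f) (hp : TorusFun f) :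
    ∃ C, ∀ k, om k ^ n * ‖fCoeff f k‖ ≤ C := by
  induction n generalizing f with
  | zero =>
    obtain ⟨B, hB⟩ := isCompact_box.exists_bound_of_continuousOn hf.continuous.continuousOn
    refine ⟨((2 * Real.pi) ^ 2)⁻¹ * (B * volume.real (box 2)), fun k => ?_⟩
    rw [fCoeff_eq, norm_smul, pow_zero, one_mul, Real.norm_of_nonneg (by positivity)]
    gcongr
    refine norm_setIntegral_le_of_norm_le_const isCompact_box.measure_lt_top fun x hx => ?_
    rw [norm_mul, norm_ee, mul_one]
    exact hB x hx
  | succ n ih =>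
    obtain ⟨C, hC⟩ := ih hf hp
    obtain ⟨C0, hC0⟩ := ih (contDiff_pd hf 0) (torusFun_pd hp 0)
    obtain ⟨C1, hC1⟩ := ih (contDiff_pd hf 1) (torusFun_pd hp 1)
    refine ⟨C + C0 + C1, fun k => ?_⟩
    have h1 : ContDiff ℝ 1 f := hf.of_le (by exact_mod_cast le_top)
    have h0 := hC0 k
    have h2 := hC1 k
    rw [fCoeff_pd h1 hp] at h0 h2
    calc om k ^ (n + 1) * ‖fCoeff f k‖ = om k ^ n * (om k * ‖fCoeff f k‖) := by ring
      _ ≤ om k ^ n * (‖fCoeff f k‖ + ‖Complex.I * k 0 * fCoeff f k‖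
            + ‖Complex.I * k 1 * fCoeff f k‖) := by
          have := om_pos k
          gcongr
          exact om_mul_norm_le k _
      _ ≤ _ := by rw [mul_add, mul_add]; exact add_le_add (add_le_add (hC k) h0) h2

lemma RD_fCoeff {f : Vd 2 → ℂ} (hf : ContDiff ℝ (⊤ : ℕ∞) f) (hp : TorusFun f) :
    RD (fCoeff f) := RD.of_bound fun n => fCoeff_decay n hf hp

/-- A periodic function descended to the unit torus, by rescaling. -/
def toTorus (f : Vd 2 → ℂ) (y : UnitAddTorus (Fin 2)) : ℂ :=
  f fun i => 2 * Real.pi * ((AddCircle.equivIoc 1 0 (y i) : Set.Ioc (0 : ℝ) (0 + 1)) : ℝ)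

lemma toTorus_coe {f : Vd 2 → ℂ} (hp : TorusFun f) (x : Vd 2) :
    toTorus f (fun i => (x i : UnitAddCircle)) = f fun i => 2 * Real.pi * x i := by
  unfold toTorus
  have h : ∀ i, ∃ m : ℤ, x i =
      ((AddCircle.equivIoc 1 0 (x i : UnitAddCircle) : Set.Ioc (0 : ℝ) (0 + 1)) : ℝ) + m := by
    intro i
    have h1 := (AddCircle.equivIoc (1 : ℝ) 0).symm_apply_apply (x i : UnitAddCircle)
    have h2 : (((AddCircle.equivIoc 1 0 (x i : UnitAddCircle) : Set.Ioc (0 : ℝ) (0 + 1)) : ℝ)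
        : UnitAddCircle) = (x i : UnitAddCircle) := h1
    rw [← sub_eq_zero, ← AddCircle.coe_sub, AddCircle.coe_eq_zero_iff] at h2
    obtain ⟨m, hm⟩ := h2
    refine ⟨-m, ?_⟩
    rw [zsmul_eq_mul, mul_one] at hm
    push_cast
    linarith
  choose m hm using h
  rw [← hp _ m]
  congr 1
  funext i
  rw [hm i]
  simp [latt]
  ring

lemma continuous_toTorus {f : Vd 2 → ℂ} (hf : Continuous f) (hp : TorusFun f) :
    Continuous (toTorus f) := by
  have hq : IsOpenQuotientMap (fun (x : Vd 2) (i : Fin 2) => (x i : UnitAddCircle)) := by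
    refine ⟨fun y => ?_, continuous_pi fun i => ?_, ?_⟩
    · choose x hx using fun i => QuotientAddGroup.mk_surjective (y i)
      exact ⟨x, funext hx⟩
    · exact (AddCircle.continuous_mk' 1).comp (continuous_apply i)
    · exact IsOpenMap.piMap (fun i => QuotientAddGroup.isOpenMap_coe) (by simp)
  rw [← hq.continuous_comp_iff]
  have : toTorus f ∘ (fun (x : Vd 2) (i : Fin 2) => (x i : UnitAddCircle))
      = fun x => f fun i => 2 * Real.pi * x i := funext fun x => toTorus_coe hp x
  rw [this]
  exact hf.comp (by fun_prop)

lemma mFourier_coe (k : Fin 2 → ℤ) (x : Vd 2) :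
    UnitAddTorus.mFourier k (fun i => (x i : UnitAddCircle))
      = ee k (fun i => 2 * Real.pi * x i) := by
  simp only [UnitAddTorus.mFourier, ContinuousMap.coe_mk, Fin.prod_univ_two, fourier_coe_apply]
  unfold ee
  rw [← Complex.exp_add, dotZ_two]
  congr 1
  push_cast
  ring

lemma mFourierCoeff_toTorus {f : Vd 2 → ℂ} (hp : TorusFun f) (k : Fin 2 → ℤ) :
    UnitAddTorus.mFourierCoeff (toTorus f) k = fCoeff f k := by
  have hpi := Real.pi_pos
  rw [UnitAddTorus.mFourierCoeff_eq_integral _ k 0, fCoeff_eq]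
  have e1 : ∀ x : Vd 2, UnitAddTorus.mFourier (-k) (fun i => (x i : UnitAddCircle)) •
      toTorus f (fun i => (x i : UnitAddCircle)) =
      (fun y => f y * ee (-k) y) ((2 * Real.pi) • x) := by
    intro x
    rw [toTorus_coe hp, mFourier_coe, smul_eq_mul, mul_comm]
    rfl
  simp only [e1]
  refine (Measure.setIntegral_comp_smul_of_pos (μ := volume) (fun y => f y * ee (-k) y)
    {x : Vd 2 | ∀ i, x i ∈ Set.Ioc ((0 : Vd 2) i) ((0 : Vd 2) i + 1)}
    (by positivity : 0 < 2 * Real.pi)).trans ?_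
  rw [Module.finrank_fin_fun]
  congr 1
  unfold box
  refine Eq.trans ?_ (setIntegral_congr_set (Measure.univ_pi_Ioc_ae_eq_Icc
    (μ := fun _ : Fin 2 => (volume : Measure ℝ)) (f := 0) (g := fun _ => 2 * Real.pi)))
  congr 2
  ext x
  rw [Set.mem_smul_set_iff_inv_smul_mem₀ (by positivity)]
  simp only [Set.mem_ofPred_eq, Set.mem_Ioc, Pi.smul_apply, smul_eq_mul, Pi.zero_apply, Set.mem_pi,
    Set.mem_univ, forall_true_left, zero_add]
  refine forall_congr' fun i => and_congr ?_ ?_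
  · constructor
    · intro h; exact (pos_iff_pos_of_mul_pos h).1 (by positivity)
    · intro h; positivity
  · rw [inv_mul_le_iff₀ (by positivity), mul_one]

lemma EE_fCoeff {f : Vd 2 → ℂ} (hf : ContDiff ℝ (⊤ : ℕ∞) f) (hp : TorusFun f) :
    EE (fCoeff f) = f := by
  have hpi := Real.pi_pos
  funext x
  have e : UnitAddTorus.mFourierCoeff (toTorus f) = fCoeff f :=
    funext (mFourierCoeff_toTorus hp)
  have hs := (RD_fCoeff hf hp).summable_norm.of_norm
  rw [← e] at hs
  have key := UnitAddTorus.hasSum_mFourier_series_apply_of_summable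
    (f := ⟨toTorus f, continuous_toTorus hf.continuous hp⟩) hs
    (fun i => (((2 * Real.pi)⁻¹ * x i : ℝ) : UnitAddCircle))
  have hx : (fun i => 2 * Real.pi * ((2 * Real.pi)⁻¹ * x i)) = x := by
    funext i; field_simp
  simp only [ContinuousMap.coe_mk] at key
  rw [toTorus_coe hp (fun i => (2 * Real.pi)⁻¹ * x i)] at key
  simp only [mFourier_coe _ (fun i => (2 * Real.pi)⁻¹ * x i), hx, e] at key
  exact key.tsum_eq

/-- The unit vector in direction `i`. -/
def ei (i : Fin 2) : Vd 2 := Pi.single i 1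

lemma norm_ei (i : Fin 2) : ‖ei i‖ = 1 := by
  rw [ei, Pi.norm_single, norm_one]

lemma hasDerivAt_EE_line {c : (Fin 2 → ℤ) → ℂ} (h : RD c) (x : Vd 2) (i : Fin 2) (r s : ℝ) :
    HasDerivAt (fun s : ℝ => EE c (x + (r * s) • ei i)) (r * EE (dC i c) (x + (r * s) • ei i)) s := by
  have h1 := (hasFDerivAt_EE h (x + (r * s) • ei i)).differentiableAt.hasFDerivAt
  have h2 : HasDerivAt (fun s : ℝ => x + (r * s) • ei i) (r • ei i) s := by
    have := (((hasDerivAt_id s).const_mul r).smul_const (ei i)).const_add x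
    simpa using this
  have h3 := h1.comp_hasDerivAt s h2
  rw [map_smul] at h3
  have h4 := congrFun (pd_EE h i) (x + (r * s) • ei i)
  unfold pd at h4
  rw [show (Pi.single i 1 : Vd 2) = ei i from rfl] at h4
  rw [h4] at h3
  refine HasDerivAt.congr_deriv (f := fun s : ℝ => EE c (x + (r * s) • ei i)) h3 ?_
  simp

lemma hasDerivAt_re_line {c : (Fin 2 → ℤ) → ℂ} (h : RD c) (x : Vd 2) (i : Fin 2) (r s : ℝ) :
    HasDerivAt (fun s : ℝ => (EE c (x + (r * s) • ei i)).re)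
      (r * (EE (dC i c) (x + (r * s) • ei i)).re) s := by
  have h1 := Complex.reCLM.hasFDerivAt.comp_hasDerivAt s (hasDerivAt_EE_line h x i r s)
  refine HasDerivAt.congr_deriv (f := fun s : ℝ => (EE c (x + (r * s) • ei i)).re) h1 ?_
  simp

lemma nonpos_of_isLocalMax {g g' : ℝ → ℝ} {a t : ℝ} (h1 : ∀ s, HasDerivAt g (g' s) s)
    (h2 : HasDerivAt g' a t) (hm : IsLocalMax g t) : a ≤ 0 := by
  by_contra! ha
  have e : deriv g = g' := funext fun s => (h1 s).deriv
  have ht : g' t = 0 := hm.hasDerivAt_eq_zero (h1 t)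
  have hmin : IsLocalMin g t := isLocalMin_of_deriv_deriv_pos (by rw [e, h2.deriv]; exact ha)
    (by rw [e, ht]) (h1 t).continuousAt
  have hc : g =ᶠ[nhds t] fun _ => g t := by
    filter_upwards [hm, hmin] with s hs1 hs2
    exact le_antisymm hs1 hs2
  have h3 : g' =ᶠ[nhds t] fun _ => 0 := by
    rw [← e]
    have := hc.deriv
    simpa using this
  have h4 : a = 0 := by
    have := h3.deriv_eq
    rw [h2.deriv] at this
    simpa using this
  linarith

lemma exists_mem_box (x : Vd 2) : ∃ m, x + latt m ∈ box 2 := by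
  have hp := Real.pi_pos
  refine ⟨fun i => -⌊x i / (2 * Real.pi)⌋, ?_⟩
  have key : ∀ i, 0 ≤ x i + 2 * Real.pi * (-(⌊x i / (2 * Real.pi)⌋ : ℝ)) ∧
      x i + 2 * Real.pi * (-(⌊x i / (2 * Real.pi)⌋ : ℝ)) ≤ 2 * Real.pi := by
    intro i
    have h1 := Int.floor_le (x i / (2 * Real.pi))
    have h2 := (Int.lt_floor_add_one (x i / (2 * Real.pi))).le
    rw [le_div_iff₀ (by positivity)] at h1
    rw [div_le_iff₀ (by positivity)] at h2
    constructor <;> nlinarith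
  constructor <;> intro i
  · simpa [latt] using (key i).1
  · simpa [latt] using (key i).2

lemma continuous_EE {c : (Fin 2 → ℤ) → ℂ} (h : RD c) : Continuous (EE c) :=
  (contDiff_EE h 0).continuous

/-- `|k|²`. -/
def nk (k : Fin 2 → ℤ) : ℝ := (k 0 : ℝ) ^ 2 + (k 1 : ℝ) ^ 2

lemma nk_nonneg (k : Fin 2 → ℤ) : 0 ≤ nk k := by unfold nk; positivity

lemma nk_le (k : Fin 2 → ℤ) : nk k ≤ 2 * om k ^ 2 := by
  have h0 := abs_coord_le_om k 0
  have h1 := abs_coord_le_om k 1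
  have := sq_le_sq' (by linarith [abs_nonneg (k 0 : ℝ), om_pos k]) h0
  have := sq_le_sq' (by linarith [abs_nonneg (k 1 : ℝ), om_pos k]) h1
  unfold nk
  rw [← sq_abs (k 0 : ℝ), ← sq_abs (k 1 : ℝ)]
  linarith

/-- Laplacian on Fourier coefficients. -/
def lapK (c : (Fin 2 → ℤ) → ℂ) : (Fin 2 → ℤ) → ℂ := fun k => -((nk k : ℝ) : ℂ) * c k

/-- The resolvent `(ξ² - Δ)⁻¹` on Fourier coefficients. -/
def resC (ξ : ℝ) (c : (Fin 2 → ℤ) → ℂ) : (Fin 2 → ℤ) → ℂ :=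
  fun k => (((ξ ^ 2 + nk k)⁻¹ : ℝ) : ℂ) * c k

/-- Translation difference on Fourier coefficients. -/
def shC (h : Vd 2) (c : (Fin 2 → ℤ) → ℂ) : (Fin 2 → ℤ) → ℂ := fun k => (ee k h - 1) * c k

variable {c : (Fin 2 → ℤ) → ℂ}

lemma RD.lapK (h : RD c) : RD (lapK c) := by
  refine h.mul_of_bound 2 2 fun k => ?_
  rw [norm_neg, Complex.norm_real, Real.norm_of_nonneg (nk_nonneg k)]
  exact nk_le k

lemma RD.resC (h : RD c) {ξ : ℝ} (hξ : 0 < ξ) : RD (resC ξ c) := by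
  refine h.mul_of_bound ((ξ ^ 2)⁻¹) 0 fun k => ?_
  have := nk_nonneg k
  rw [Complex.norm_real, Real.norm_of_nonneg (by positivity), pow_zero, mul_one]
  exact inv_anti₀ (by positivity) (by linarith)

lemma RD.shC (h : RD c) (y : Vd 2) : RD (shC y c) := by
  refine h.mul_of_bound 2 0 fun k => ?_
  have := norm_sub_le (ee k y) 1
  rw [norm_ee, norm_one] at this
  linarith

lemma RD.const_mul (h : RD c) (z : ℂ) : RD (fun k => z * c k) :=
  h.mul_of_bound ‖z‖ 0 fun k => by simp

lemma EE_const_mul (z : ℂ) (c : (Fin 2 → ℤ) → ℂ) (x : Vd 2) :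
    EE (fun k => z * c k) x = z * EE c x := by
  unfold EE
  rw [← tsum_mul_left]
  simp only [mul_assoc]

lemma EE_add {c d : (Fin 2 → ℤ) → ℂ} (hc : RD c) (hd : RD d) (x : Vd 2) :
    EE (fun k => c k + d k) x = EE c x + EE d x := by
  unfold EE
  rw [← (hc.summable x).tsum_add (hd.summable x)]
  simp only [add_mul]

lemma EE_shC (h : RD c) (y x : Vd 2) : EE (shC y c) x = EE c (x + y) - EE c x := by
  unfold EE
  rw [← (h.summable (x + y)).tsum_sub (h.summable x)]
  refine tsum_congr fun k => ?_
  rw [ee_add_right]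
  unfold shC
  ring

lemma EE_lapK (h : RD c) (x : Vd 2) :
    EE (lapK c) x = EE (dC 0 (dC 0 c)) x + EE (dC 1 (dC 1 c)) x := by
  rw [← EE_add ((h.dC 0).dC 0) ((h.dC 1).dC 1)]
  congr 1
  funext k
  unfold lapK dC nk
  push_cast
  linear_combination (-(k 0 : ℂ) ^ 2 - (k 1 : ℂ) ^ 2) * c k * Complex.I_sq

lemma EE_lapK_resC (h : RD c) {ξ : ℝ} (hξ : 0 < ξ) (x : Vd 2) :
    EE (lapK (resC ξ c)) x = (ξ : ℂ) ^ 2 * EE (resC ξ c) x - EE c x := by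
  have e : EE (resC ξ c) x * (ξ : ℂ) ^ 2 = EE (fun k => (ξ : ℂ) ^ 2 * resC ξ c k) x := by
    rw [EE_const_mul, mul_comm]
  rw [mul_comm, e]
  have e2 : EE (fun k => (ξ : ℂ) ^ 2 * resC ξ c k) x = EE (lapK (resC ξ c)) x + EE c x := by
    rw [← EE_add (h.resC hξ).lapK h]
    congr 1
    funext k
    unfold lapK resC
    have : ((ξ ^ 2 + nk k : ℝ) : ℂ) ≠ 0 := by
      have := nk_nonneg k
      exact_mod_cast (by positivity : ξ ^ 2 + nk k ≠ 0)
    push_cast at this ⊢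
    field_simp
    ring
  rw [e2]; ring

lemma exists_max_re (h : RD c) : ∃ x0, ∀ x, (EE c x).re ≤ (EE c x0).re := by
  obtain ⟨x0, _, hx0⟩ := isCompact_box.exists_isMaxOn (⟨0, by
    constructor <;> intro i <;> simp [Real.pi_pos.le]⟩ : (box 2).Nonempty)
    (Complex.continuous_re.comp (continuous_EE h)).continuousOn
  refine ⟨x0, fun x => ?_⟩
  obtain ⟨m, hm⟩ := exists_mem_box x
  rw [← EE_latt c x m]
  exact hx0 hm

lemma norm_le_of_re_le {w : ℂ} {B : ℝ} (h : ∀ z : ℂ, ‖z‖ = 1 → (z * w).re ≤ B) : ‖w‖ ≤ B := by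
  by_cases hw : w = 0
  · have := h 1 (by simp)
    simpa [hw] using this
  · have hn : (‖w‖ : ℂ) ≠ 0 := by simpa using hw
    have := h ((starRingEnd ℂ) w / ‖w‖) (by simp [hw])
    rw [div_mul_eq_mul_div, Complex.conj_mul', pow_two, mul_div_assoc, div_self hn, mul_one] at this
    simpa using this

lemma dd_nonpos_of_max (h : RD c) (i : Fin 2) {x0 : Vd 2}
    (hm : ∀ x, (EE c x).re ≤ (EE c x0).re) : (EE (dC i (dC i c)) x0).re ≤ 0 := by
  have h2 := hasDerivAt_re_line (h.dC i) x0 i 1 0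
  refine nonpos_of_isLocalMax (g := fun s : ℝ => (EE c (x0 + (1 * s) • ei i)).re)
    (g' := fun s : ℝ => (EE (dC i c) (x0 + (1 * s) • ei i)).re) (t := 0) ?_ ?_ ?_
  · intro s; simpa using hasDerivAt_re_line h x0 i 1 s
  · simpa using h2
  · exact Filter.Eventually.of_forall fun s => by simpa using hm _

lemma norm_resC_le (h : RD c) {ξ A : ℝ} (hξ : 0 < ξ) (hA : ∀ x, ‖EE c x‖ ≤ A) (x : Vd 2) :
    ‖EE (resC ξ c) x‖ ≤ A / ξ ^ 2 := by
  refine norm_le_of_re_le fun z hz => ?_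
  rw [← EE_const_mul]
  have hr : RD (fun k => z * resC ξ c k) := (h.resC hξ).const_mul z
  obtain ⟨x0, hx0⟩ := exists_max_re hr
  refine (hx0 x).trans ?_
  have e := EE_lapK hr x0
  have e2 := EE_lapK_resC (h.const_mul z) hξ x0
  have e3 : resC ξ (fun k => z * c k) = fun k => z * resC ξ c k := by
    funext k; unfold resC; ring
  rw [e3, e] at e2
  have := dd_nonpos_of_max hr 0 hx0
  have := dd_nonpos_of_max hr 1 hx0
  have e4 := congrArg Complex.re e2
  have h5 : (EE (fun k => z * c k) x0).re ≤ A := by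
    rw [EE_const_mul]
    refine (Complex.re_le_norm _).trans ?_
    rw [norm_mul, hz, one_mul]
    exact hA x0
  rw [← Complex.ofReal_pow] at e4
  simp only [Complex.add_re, Complex.sub_re, Complex.re_ofReal_mul] at e4
  rw [le_div_iff₀ (by positivity)]
  nlinarith

section

variable {c : (Fin 2 → ℤ) → ℂ}

/-- Hölder bound of exponent `α` with constant `A`. -/
def HB (α A : ℝ) (c : (Fin 2 → ℤ) → ℂ) : Prop := ∀ h x, ‖EE (shC h c) x‖ ≤ A * ‖h‖ ^ α

lemma HB.mono {α A B : ℝ} (h : HB α A c) (hAB : A ≤ B) : HB α B c := fun y x =>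
  (h y x).trans (mul_le_mul_of_nonneg_right hAB (by positivity))

lemma shC_mul (m : (Fin 2 → ℤ) → ℂ) (h : Vd 2) :
    shC h (fun k => m k * c k) = fun k => m k * shC h c k := by
  funext k; unfold shC; ring

lemma dC_mul (m : (Fin 2 → ℤ) → ℂ) (i : Fin 2) :
    dC i (fun k => m k * c k) = fun k => m k * dC i c k := by
  funext k; unfold dC; ring

/-- Squared Euclidean distance. -/
def sqd (x y : Vd 2) : ℝ := (x 0 - y 0) ^ 2 + (x 1 - y 1) ^ 2

lemma sqd_line (x y : Vd 2) (i : Fin 2) (s : ℝ) :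
    sqd (y + (1 * s) • ei i) x = sqd y x + 2 * s * (y i - x i) + s ^ 2 := by
  unfold sqd ei
  fin_cases i <;> simp <;> ring

lemma norm_sq_le_sqd (x y : Vd 2) : ‖x - y‖ ^ 2 ≤ sqd x y := by
  have : ‖x - y‖ ≤ Real.sqrt (sqd x y) := by
    rw [pi_norm_le_iff_of_nonneg (by positivity)]
    intro i
    rw [Real.norm_eq_abs]
    refine Real.abs_le_sqrt ?_
    unfold sqd
    fin_cases i <;> simp <;> positivity
  have h2 : 0 ≤ sqd x y := by unfold sqd; positivity
  calc ‖x - y‖ ^ 2 ≤ Real.sqrt (sqd x y) ^ 2 := by gcongr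
    _ = _ := Real.sq_sqrt h2

lemma exists_max_barrier (h : RD c) {K : ℝ} (hK : 0 < K) (x0 : Vd 2) :
    ∃ y0, ∀ y, (EE c y).re - K * sqd y x0 ≤ (EE c y0).re - K * sqd y0 x0 := by
  set V := ∑' k, ‖c k‖ with hV
  have hVn : 0 ≤ V := tsum_nonneg fun _ => norm_nonneg _
  have hre : ∀ y, |(EE c y).re| ≤ V := fun y => (Complex.abs_re_le_norm _).trans (norm_EE_le h y)
  set R := Real.sqrt (2 * V / K) with hR
  have hR2 : R ^ 2 = 2 * V / K := Real.sq_sqrt (by positivity)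
  have hcont : Continuous fun y : Vd 2 => (EE c y).re - K * sqd y x0 := by
    refine (Complex.continuous_re.comp (continuous_EE h)).sub (continuous_const.mul ?_)
    unfold sqd
    fun_prop
  obtain ⟨y0, _, hy0⟩ := (isCompact_closedBall x0 R).exists_isMaxOn
    ⟨x0, Metric.mem_closedBall_self (Real.sqrt_nonneg _)⟩ hcont.continuousOn
  refine ⟨y0, fun y => ?_⟩
  by_cases hy : y ∈ Metric.closedBall x0 R
  · exact hy0 hy
  · have h1 : R < ‖y - x0‖ := by simpa [dist_eq_norm] using hy
    have h2 := norm_sq_le_sqd y x0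
    have h3 : R ^ 2 ≤ sqd y x0 := le_trans (by gcongr) h2
    have h4 : 2 * V ≤ K * sqd y x0 := by
      rw [hR2, div_le_iff₀ hK] at h3
      linarith
    have h5 := hy0 (Metric.mem_closedBall_self (Real.sqrt_nonneg _) : x0 ∈ _)
    simp only [Set.mem_ofPred_eq] at h5
    have h6 : sqd x0 x0 = 0 := by simp [sqd]
    rw [h6] at h5
    have := abs_le.1 (hre y)
    have := abs_le.1 (hre x0)
    linarith

lemma rpow_le_one_add_sq {α t : ℝ} (h0 : 0 ≤ α) (h1 : α ≤ 1) (ht : 0 ≤ t) :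
    t ^ α ≤ 1 + t ^ 2 := by
  rcases le_total t 1 with h | h
  · have := Real.rpow_le_one ht h h0
    nlinarith
  · have : t ^ α ≤ t ^ (1 : ℝ) := Real.rpow_le_rpow_of_exponent_le h h1
    rw [Real.rpow_one] at this
    nlinarith

lemma norm_lapK_resC_le_aux (h : RD c) {α ξ B : ℝ} (h0 : 0 ≤ α) (h1 : α ≤ 1) (hξ : 0 < ξ) (hB : 0 < B)
    (hc : HB α B c) (x0 : Vd 2) : ‖EE (lapK (resC ξ c)) x0‖ ≤ 5 * B * ξ ^ (-α) := by
  refine norm_le_of_re_le fun z hz => ?_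
  rw [← EE_const_mul]
  set d : (Fin 2 → ℤ) → ℂ := fun k => z * c k with hd
  have hdR : RD d := h.const_mul z
  have e0 : (fun k => z * lapK (resC ξ c) k) = lapK (resC ξ d) := by
    funext k; simp only [hd, resC, lapK]; ring
  rw [e0, EE_lapK_resC hdR hξ]
  set v := resC ξ d with hv
  have hvR : RD v := hdR.resC hξ
  set K := B * ξ ^ (-α) with hK
  have hKp : 0 < K := by positivity
  obtain ⟨y, hy⟩ := exists_max_barrier hvR hKp x0
  have hdd : ∀ i, (EE (dC i (dC i v)) y).re ≤ 2 * K := by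
    intro i
    have key := nonpos_of_isLocalMax
      (g := fun s : ℝ => (EE v (y + (1 * s) • ei i)).re - K * sqd (y + (1 * s) • ei i) x0)
      (g' := fun s : ℝ => (EE (dC i v) (y + (1 * s) • ei i)).re - K * (2 * (y i - x0 i) + 2 * s))
      (a := (EE (dC i (dC i v)) y).re - K * 2) (t := 0) ?_ ?_ ?_
    · linarith
    · intro s
      simp only [sqd_line]
      have a1 := hasDerivAt_re_line hvR y i 1 s
      have a2 : HasDerivAt (fun s : ℝ => K * (sqd y x0 + 2 * s * (y i - x0 i) + s ^ 2))
          (K * (2 * (y i - x0 i) + 2 * s)) s := by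
        have := (((((hasDerivAt_id s).const_mul 2).mul_const (y i - x0 i)).const_add (sqd y x0)).add
          ((hasDerivAt_id s).pow 2)).const_mul K
        refine this.congr_deriv ?_
        simp
      have := a1.sub a2
      rw [one_mul] at this
      exact this
    · have a1 := hasDerivAt_re_line (hvR.dC i) y i 1 0
      have a2 : HasDerivAt (fun s : ℝ => K * (2 * (y i - x0 i) + 2 * s)) (K * 2) 0 := by
        have := (((hasDerivAt_id (0 : ℝ)).const_mul 2).const_add (2 * (y i - x0 i))).const_mul K
        simpa using this
      refine (a1.sub a2).congr_deriv ?_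
      simp
    · exact Filter.Eventually.of_forall fun s => by simpa using hy _
  have e := EE_lapK_resC hdR hξ y
  rw [EE_lapK hvR] at e
  have e1 := congrArg Complex.re e
  rw [← Complex.ofReal_pow] at e1 ⊢
  simp only [Complex.add_re, Complex.sub_re, Complex.re_ofReal_mul] at e1 ⊢
  have hx0 := hy x0
  have h6 : sqd x0 x0 = 0 := by simp [sqd]
  rw [h6] at hx0
  have hw : (EE d y).re - (EE d x0).re ≤ B * ‖y - x0‖ ^ α := by
    have := hc (y - x0) x0
    rw [EE_shC h, add_sub_cancel] at this
    rw [hd, EE_const_mul, EE_const_mul, ← Complex.sub_re, ← mul_sub]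
    refine (Complex.re_le_norm _).trans ?_
    rwa [norm_mul, hz, one_mul]
  have h7 := norm_sq_le_sqd y x0
  have h8 : B * ‖y - x0‖ ^ α ≤ K * (1 + ξ ^ 2 * sqd y x0) := by
    have := rpow_le_one_add_sq h0 h1 (t := ξ * ‖y - x0‖) (by positivity)
    rw [Real.mul_rpow hξ.le (norm_nonneg _), mul_pow] at this
    have h9 : B * ‖y - x0‖ ^ α = K * (ξ ^ α * ‖y - x0‖ ^ α) := by
      rw [hK, Real.rpow_neg hξ.le]
      field_simp
    rw [h9]
    refine mul_le_mul_of_nonneg_left (this.trans ?_) hKp.le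
    gcongr
  have := hdd 0
  have := hdd 1
  have h10 : ξ ^ 2 * (EE v x0).re ≤ ξ ^ 2 * ((EE v y).re - K * sqd y x0) := by
    refine mul_le_mul_of_nonneg_left ?_ (by positivity)
    linarith
  have : 5 * B * ξ ^ (-α) = 5 * K := by rw [hK]; ring
  nlinarith

lemma norm_lapK_resC_le (h : RD c) {α ξ B : ℝ} (h0 : 0 ≤ α) (h1 : α ≤ 1) (hξ : 0 < ξ) (hB : 0 ≤ B)
    (hc : HB α B c) (x0 : Vd 2) : ‖EE (lapK (resC ξ c)) x0‖ ≤ 5 * B * ξ ^ (-α) := by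
  have key : ∀ ε > 0, ‖EE (lapK (resC ξ c)) x0‖ ≤ 5 * (B + ε) * ξ ^ (-α) := fun ε hε =>
    norm_lapK_resC_le_aux h h0 h1 hξ (by linarith) (hc.mono (by linarith)) x0
  have hp : 0 < ξ ^ (-α) := by positivity
  refine le_of_forall_pos_le_add fun ε hε => ?_
  refine (key (ε / (5 * ξ ^ (-α))) (by positivity)).trans (le_of_eq ?_)
  field_simp

/-- Symmetric difference in direction `i`. -/
lemma dd_nonpos_symm (h : RD c) (i : Fin 2) {x0 : Vd 2} {s : ℝ} (j : Fin 2)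
    (hm : ∀ x, (EE c (x + s • ei i)).re - (EE c (x + (-s) • ei i)).re ≤
      (EE c (x0 + s • ei i)).re - (EE c (x0 + (-s) • ei i)).re) :
    (EE (dC j (dC j c)) (x0 + s • ei i)).re - (EE (dC j (dC j c)) (x0 + (-s) • ei i)).re ≤ 0 := by
  refine nonpos_of_isLocalMax
    (g := fun t : ℝ => (EE c ((x0 + s • ei i) + (1 * t) • ei j)).re
      - (EE c ((x0 + (-s) • ei i) + (1 * t) • ei j)).re)
    (g' := fun t : ℝ => (EE (dC j c) ((x0 + s • ei i) + (1 * t) • ei j)).re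
      - (EE (dC j c) ((x0 + (-s) • ei i) + (1 * t) • ei j)).re) (t := 0) ?_ ?_ ?_
  · intro t
    refine ((hasDerivAt_re_line h (x0 + s • ei i) j 1 t).sub
      (hasDerivAt_re_line h (x0 + (-s) • ei i) j 1 t)).congr_deriv ?_
    simp
  · refine ((hasDerivAt_re_line (h.dC j) (x0 + s • ei i) j 1 0).sub
      (hasDerivAt_re_line (h.dC j) (x0 + (-s) • ei i) j 1 0)).congr_deriv ?_
    simp
  · refine Filter.Eventually.of_forall fun t => ?_
    have := hm (x0 + (1 * t) • ei j)
    simp only [mul_zero, zero_smul, add_zero]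
    rw [add_right_comm _ _ (s • ei i), add_right_comm _ _ ((-s) • ei i)] at this
    exact this

lemma symm_diff_le (h : RD c) (i : Fin 2) {M L δ : ℝ} (hδ : 0 < δ) (hL : 0 < L)
    (hM : ∀ x s, 0 ≤ s → s ≤ δ → ‖EE c (x + s • ei i) - EE c (x + (-s) • ei i)‖ ≤ M)
    (hLap : ∀ x s, 0 ≤ s → s ≤ δ →
      ‖EE (lapK c) (x + s • ei i) - EE (lapK c) (x + (-s) • ei i)‖ ≤ L)
    (x : Vd 2) {s : ℝ} (hs0 : 0 ≤ s) (hsδ : s ≤ δ) :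
    (EE c (x + s • ei i)).re - (EE c (x + (-s) • ei i)).re ≤ (M / δ + L * δ) * s - L * s ^ 2 := by
  have hM0 : 0 ≤ M := (norm_nonneg _).trans (hM 0 0 le_rfl hδ.le)
  set P : Vd 2 × ℝ → ℝ := fun p => (EE c (p.1 + p.2 • ei i)).re - (EE c (p.1 + (-p.2) • ei i)).re
    - ((M / δ + L * δ) * p.2 - L * p.2 ^ 2) with hP
  have hcr := Complex.continuous_re.comp (continuous_EE h)
  have hPc : Continuous P := by
    refine ((hcr.comp (g := fun y : Vd 2 => (EE c y).re) ?_).sub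
      (hcr.comp (g := fun y : Vd 2 => (EE c y).re) ?_)).sub ?_ <;> fun_prop
  have hper : ∀ y m t, P (y + latt m, t) = P (y, t) := by
    intro y m t
    simp only [hP]
    rw [add_right_comm, EE_latt, add_right_comm, EE_latt]
  have h0box : (0 : Vd 2) ∈ box 2 := by constructor <;> intro i <;> simp [Real.pi_pos.le]
  obtain ⟨⟨x0, s0⟩, hmem, hmax⟩ := (isCompact_box.prod (isCompact_Icc (a := (0 : ℝ)) (b := δ))).exists_isMaxOn
    ⟨(0, 0), h0box, by simp [hδ.le]⟩ hPc.continuousOn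
  have hmax' : ∀ y t, 0 ≤ t → t ≤ δ → P (y, t) ≤ P (x0, s0) := by
    intro y t ht0 ht1
    obtain ⟨m, hm⟩ := exists_mem_box y
    rw [← hper y m t]
    exact hmax ⟨hm, ht0, ht1⟩
  have hs0m : 0 ≤ s0 ∧ s0 ≤ δ := hmem.2
  suffices hle : P (x0, s0) ≤ 0 by
    have := (hmax' x s hs0 hsδ).trans hle
    simp only [hP] at this
    linarith
  rcases eq_or_lt_of_le hs0m.1 with hz | hpos
  · simp [hP, ← hz]
  rcases eq_or_lt_of_le hs0m.2 with hz | hlt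
  · have := (Complex.re_le_norm _).trans (hM x0 δ hδ.le le_rfl)
    rw [Complex.sub_re] at this
    simp only [hP, hz]
    have e : (M / δ + L * δ) * δ - L * δ ^ 2 = M := by field_simp; ring
    rw [e]; linarith
  exfalso
  have hW : ∀ y, (EE c (y + s0 • ei i)).re - (EE c (y + (-s0) • ei i)).re ≤
      (EE c (x0 + s0 • ei i)).re - (EE c (x0 + (-s0) • ei i)).re := by
    intro y
    have := hmax' y s0 hs0m.1 hs0m.2
    simp only [hP] at this
    linarith
  have hj := fun j => dd_nonpos_symm h i j hW
  have hi : ((EE (dC i (dC i c)) (x0 + s0 • ei i)).re - (EE (dC i (dC i c)) (x0 + (-s0) • ei i)).re)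
      + 2 * L ≤ 0 := by
    refine nonpos_of_isLocalMax (g := fun t => P (x0, t))
      (g' := fun t => (EE (dC i c) (x0 + t • ei i)).re + (EE (dC i c) (x0 + (-t) • ei i)).re
        - ((M / δ + L * δ) - 2 * L * t)) (t := s0) ?_ ?_ ?_
    · intro t
      have a1 := hasDerivAt_re_line h x0 i 1 t
      have a2 := hasDerivAt_re_line h x0 i (-1) t
      have a3 : HasDerivAt (fun t => (M / δ + L * δ) * t - L * t ^ 2)
          ((M / δ + L * δ) - 2 * L * t) t := by
        have := ((hasDerivAt_id t).const_mul (M / δ + L * δ)).sub (((hasDerivAt_id t).pow 2).const_mul L)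
        refine this.congr_deriv ?_
        simp; ring
      have := (a1.sub a2).sub a3
      simp only [one_mul, neg_one_mul, sub_neg_eq_add] at this
      exact this
    · have a1 := hasDerivAt_re_line (h.dC i) x0 i 1 s0
      have a2 := hasDerivAt_re_line (h.dC i) x0 i (-1) s0
      have a3 : HasDerivAt (fun t => (M / δ + L * δ) - 2 * L * t) (- (2 * L)) s0 := by
        have := ((hasDerivAt_id s0).const_mul (2 * L)).const_sub (M / δ + L * δ)
        simpa using this
      have := (a1.add a2).sub a3
      simp only [one_mul, neg_one_mul, sub_neg_eq_add, ← sub_eq_add_neg] at this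
      exact this
    · filter_upwards [Ioo_mem_nhds hpos hlt] with t ht
      exact hmax' x0 t ht.1.le ht.2.le
  have hLl := (Complex.abs_re_le_norm _).trans (hLap x0 s0 hs0m.1 hs0m.2)
  rw [EE_lapK h, EE_lapK h] at hLl
  simp only [Complex.sub_re, Complex.add_re] at hLl
  have := (abs_le.1 hLl).1
  have h0 := hj 0
  have h1 := hj 1
  fin_cases i <;> simp at hi h0 h1 this <;> linarith

lemma norm_dC_le_aux (h : RD c) (i : Fin 2) {M L δ : ℝ} (hδ : 0 < δ) (hL : 0 < L)
    (hM : ∀ x s, 0 ≤ s → s ≤ δ → ‖EE c (x + s • ei i) - EE c (x + (-s) • ei i)‖ ≤ M)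
    (hLap : ∀ x s, 0 ≤ s → s ≤ δ →
      ‖EE (lapK c) (x + s • ei i) - EE (lapK c) (x + (-s) • ei i)‖ ≤ L) (x : Vd 2) :
    ‖EE (dC i c) x‖ ≤ (M / δ + L * δ) / 2 := by
  refine norm_le_of_re_le fun z hz => ?_
  rw [← EE_const_mul, ← dC_mul (fun _ => z)]
  set d : (Fin 2 → ℤ) → ℂ := fun k => z * c k with hd
  have hdR : RD d := h.const_mul z
  have e : lapK d = fun k => z * lapK c k := by funext k; simp only [hd, lapK]; ring
  have key := fun s (hs0 : 0 ≤ s) (hsδ : s ≤ δ) =>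
    symm_diff_le hdR i (M := M) hδ hL (fun x s h0 h1 => by
      rw [hd, EE_const_mul, EE_const_mul, ← mul_sub, norm_mul, hz, one_mul]
      exact hM x s h0 h1) (fun x s h0 h1 => by
      rw [e, EE_const_mul, EE_const_mul, ← mul_sub, norm_mul, hz, one_mul]
      exact hLap x s h0 h1) x hs0 hsδ
  have a1 := hasDerivAt_re_line hdR x i 1 0
  have a2 := hasDerivAt_re_line hdR x i (-1) 0
  have a3 := a1.sub a2
  simp only [mul_zero, zero_smul, add_zero] at a3
  have a4 := (hasDerivAt_iff_tendsto_slope.1 a3).mono_left (nhdsGT_le_nhdsNE 0)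
  have hev : ∀ᶠ s in nhdsWithin (0 : ℝ) (Set.Ioi 0),
      slope ((fun s : ℝ => (EE d (x + (1 * s) • ei i)).re) - fun s : ℝ => (EE d (x + (-1 * s) • ei i)).re) 0 s
        ≤ M / δ + L * δ := by
    have hm : Set.Iic δ ∈ nhdsWithin (0 : ℝ) (Set.Ioi 0) :=
      mem_nhdsWithin_of_mem_nhds (Iic_mem_nhds hδ)
    filter_upwards [hm, self_mem_nhdsWithin] with s hs1 hs2
    have hs0 : 0 < s := hs2
    have := key s hs0.le hs1
    rw [slope_def_field]
    simp only [Pi.sub_apply, one_mul, neg_one_mul, zero_smul, add_zero, sub_self, sub_zero, neg_zero]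
    rw [div_le_iff₀ hs0]
    nlinarith [sq_nonneg s]
  have := le_of_tendsto a4 hev
  linarith

lemma norm_dC_le (h : RD c) (i : Fin 2) {M L δ : ℝ} (hδ : 0 < δ)
    (hM : ∀ x s, 0 ≤ s → s ≤ δ → ‖EE c (x + s • ei i) - EE c (x + (-s) • ei i)‖ ≤ M)
    (hLap : ∀ x, ‖EE (lapK c) x‖ ≤ L) (x : Vd 2) :
    ‖EE (dC i c) x‖ ≤ (M / δ + 2 * L * δ) / 2 := by
  have hL0 : 0 ≤ L := (norm_nonneg _).trans (hLap 0)
  refine le_of_forall_pos_le_add fun ε hε => ?_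
  refine (norm_dC_le_aux h i (L := 2 * L + 2 * ε / δ) hδ (by positivity) hM (fun x s _ _ => ?_) x).trans
    (le_of_eq ?_)
  · refine (norm_sub_le _ _).trans ?_
    have := hLap (x + s • ei i)
    have := hLap (x + (-s) • ei i)
    have : 0 < 2 * ε / δ := by positivity
    linarith
  · field_simp; ring

end

section

variable {c : (Fin 2 → ℤ) → ℂ}

lemma norm_lapK_resC_le_sup (h : RD c) {ξ A : ℝ} (hξ : 0 < ξ) (hA : ∀ x, ‖EE c x‖ ≤ A) (x : Vd 2) :
    ‖EE (lapK (resC ξ c)) x‖ ≤ 2 * A := by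
  rw [EE_lapK_resC h hξ]
  refine (norm_sub_le _ _).trans ?_
  have h1 := norm_resC_le h hξ hA x
  rw [le_div_iff₀ (by positivity)] at h1
  rw [norm_mul, norm_pow, Complex.norm_real, Real.norm_of_nonneg hξ.le]
  linarith [hA x]

lemma norm_dC_resC_le (h : RD c) {ξ A : ℝ} (hξ : 0 < ξ) (hA : ∀ x, ‖EE c x‖ ≤ A) (i : Fin 2)
    (x : Vd 2) : ‖EE (dC i (resC ξ c)) x‖ ≤ 3 * A / ξ := by
  refine (norm_dC_le (h.resC hξ) i (M := 2 * (A / ξ ^ 2)) (δ := 1 / ξ) (by positivity)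
    (fun x s _ _ => ?_) (norm_lapK_resC_le_sup h hξ hA) x).trans (le_of_eq ?_)
  · refine (norm_sub_le _ _).trans ?_
    linarith [norm_resC_le h hξ hA (x + s • ei i), norm_resC_le h hξ hA (x + (-s) • ei i)]
  · field_simp; ring

lemma shC_resC (y : Vd 2) (ξ : ℝ) : shC y (resC ξ c) = resC ξ (shC y c) := by
  funext k; unfold shC resC; ring

lemma shC_dC (y : Vd 2) (i : Fin 2) : shC y (dC i c) = dC i (shC y c) := by
  funext k; unfold shC dC; ring

lemma shC_lapK (y : Vd 2) : shC y (lapK c) = lapK (shC y c) := by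
  funext k; unfold shC lapK; ring

lemma dC_resC (i : Fin 2) (ξ : ℝ) : dC i (resC ξ c) = resC ξ (dC i c) := by
  funext k; unfold dC resC; ring

lemma dC_comm (i j : Fin 2) : dC i (dC j c) = dC j (dC i c) := by
  funext k; unfold dC; ring

lemma HB.resC {α A ξ : ℝ} (hc : HB α A c) (h : RD c) (hξ : 0 < ξ) :
    HB α (A / ξ ^ 2) (resC ξ c) := by
  intro y x
  rw [shC_resC]
  refine (norm_resC_le (h.shC y) hξ (hc y) x).trans (le_of_eq ?_)
  ring

lemma HB.dC_resC {α A ξ : ℝ} (hc : HB α A c) (h : RD c) (hξ : 0 < ξ) (i : Fin 2) :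
    HB α (3 * A / ξ) (dC i (_root_.resC ξ c)) := by
  intro y x
  rw [shC_dC, shC_resC]
  refine (norm_dC_resC_le (h.shC y) hξ (hc y) i x).trans (le_of_eq ?_)
  ring

lemma HB.lapK_resC {α A ξ : ℝ} (hc : HB α A c) (h : RD c) (hξ : 0 < ξ) :
    HB α (2 * A) (lapK (_root_.resC ξ c)) := by
  intro y x
  rw [shC_lapK, shC_resC]
  refine (norm_lapK_resC_le_sup (h.shC y) hξ (hc y) x).trans (le_of_eq ?_)
  ring

lemma HB.nonneg {α A : ℝ} (hc : HB α A c) : 0 ≤ A := by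
  have := (norm_nonneg _).trans (hc (ei 0) 0)
  simpa [norm_ei] using this

lemma symm_eq_shC (h : RD c) (x e : Vd 2) (s : ℝ) :
    EE c (x + s • e) - EE c (x + (-s) • e) = EE (shC ((2 * s) • e) c) (x + (-s) • e) := by
  rw [EE_shC h]
  congr 2
  module

lemma norm_dC_resC_le_holder (h : RD c) {ξ α B : ℝ} (h0 : 0 ≤ α) (h1 : α ≤ 1) (hξ : 0 < ξ)
    (hc : HB α B c) (i : Fin 2) (x : Vd 2) :
    ‖EE (dC i (resC ξ c)) x‖ ≤ 6 * B * ξ ^ (-α) / ξ := by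
  have hB := hc.nonneg
  refine (norm_dC_le (h.resC hξ) i (M := (B / ξ ^ 2) * (2 * ξ ^ (-α))) (δ := 1 / ξ) (by positivity)
    (fun x s hs0 hs1 => ?_) (norm_lapK_resC_le h h0 h1 hξ hB hc) x).trans (le_of_eq ?_)
  · rw [symm_eq_shC (h.resC hξ)]
    refine (hc.resC h hξ _ _).trans (mul_le_mul_of_nonneg_left ?_ (by positivity))
    rw [norm_smul, norm_ei, mul_one, Real.norm_of_nonneg (by positivity)]
    have e : ξ ^ (-α) = (1 / ξ) ^ α := by
      rw [one_div, Real.inv_rpow hξ.le, Real.rpow_neg hξ.le]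
    calc (2 * s) ^ α ≤ (2 * (1 / ξ)) ^ α := by gcongr
      _ = 2 ^ α * ξ ^ (-α) := by rw [Real.mul_rpow (by norm_num) (by positivity), e]
      _ ≤ 2 ^ (1 : ℝ) * ξ ^ (-α) := by
        gcongr
        norm_num
      _ = _ := by rw [Real.rpow_one]
  · field_simp; ring

lemma integral_box_EE (h : RD c) (h0 : c 0 = 0) : ∫ x in box 2, EE c x = 0 := by
  have := congrFun (fCoeff_EE h) 0
  rw [fCoeff_eq, h0, smul_eq_zero] at this
  simp only [neg_zero, ee_zero, mul_one] at this
  rcases this with h1 | h1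
  · exfalso
    have := Real.pi_pos
    have : (((2 * Real.pi) ^ 2)⁻¹ : ℝ) ≠ 0 := by positivity
    exact this h1
  · exact h1

lemma norm_EE_le_of_osc (h : RD c) (h0 : c 0 = 0) {A : ℝ}
    (hA : ∀ x ∈ box 2, ∀ y ∈ box 2, ‖EE c x - EE c y‖ ≤ A) (x : Vd 2) : ‖EE c x‖ ≤ A := by
  obtain ⟨m, hm⟩ := exists_mem_box x
  rw [← EE_latt c x m]
  set x' := x + latt m
  have hv : volume (box 2) ≠ ⊤ := by rw [volume_box]; exact ENNReal.ofReal_ne_top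
  have hpi := Real.pi_pos
  have hvr : volume.real (box 2) = (2 * Real.pi) ^ 2 := by
    rw [measureReal_def, volume_box, ENNReal.toReal_ofReal (by positivity)]
  have hint : IntegrableOn (EE c) (box 2) := (continuous_EE h).continuousOn.integrableOn_compact isCompact_box
  have e : ∫ y in box 2, (EE c x' - EE c y) = (volume.real (box 2)) • EE c x' := by
    have hint2 : IntegrableOn (fun _ => EE c x') (box 2) := continuousOn_const.integrableOn_compact isCompact_box
    rw [integral_sub hint2 hint, integral_box_EE h h0, setIntegral_const, sub_zero]
  have h1 := norm_setIntegral_le_of_norm_le_const (μ := volume) (s := box 2) (C := A) (f := fun y => EE c x' - EE c y)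
    hv.lt_top (fun y hy => hA x' hm y hy)
  rw [e, norm_smul, Real.norm_of_nonneg (by positivity), mul_comm, hvr] at h1
  exact le_of_mul_le_mul_right h1 (by positivity)

lemma norm_sub_le_box {x y : Vd 2} (hx : x ∈ box 2) (hy : y ∈ box 2) : ‖x - y‖ ≤ 7 := by
  have := Real.pi_lt_d2
  rw [pi_norm_le_iff_of_nonneg (by norm_num)]
  intro i
  have a1 := hx.1 i
  have a2 := hx.2 i
  have a3 := hy.1 i
  have a4 := hy.2 i
  simp only [Pi.zero_apply] at a1 a2 a3 a4
  rw [Real.norm_eq_abs, Pi.sub_apply, abs_le]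
  constructor <;> linarith

lemma HB.sup_le {α A : ℝ} (h0 : 0 ≤ α) (h1 : α ≤ 1) (hc : HB α A c) (h : RD c) (hz : c 0 = 0) (x : Vd 2) :
    ‖EE c x‖ ≤ 7 * A := by
  refine norm_EE_le_of_osc h hz (fun x hx y hy => ?_) x
  have := hc (x - y) y
  rw [EE_shC h, add_sub_cancel] at this
  refine this.trans ?_
  rw [mul_comm]
  refine mul_le_mul_of_nonneg_right ?_ hc.nonneg
  calc ‖x - y‖ ^ α ≤ 7 ^ α := by gcongr; exact norm_sub_le_box hx hy
    _ ≤ 7 ^ (1 : ℝ) := by gcongr; norm_num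
    _ = 7 := Real.rpow_one _

lemma norm_shC_le_grad (h : RD c) {G : ℝ} (hG : ∀ i x, ‖EE (dC i c) x‖ ≤ G) (y x : Vd 2) :
    ‖EE (shC y c) x‖ ≤ 2 * G * ‖y‖ := by
  rw [EE_shC h]
  have hG0 : 0 ≤ G := (norm_nonneg _).trans (hG 0 0)
  have key := Convex.norm_image_sub_le_of_norm_hasFDerivWithin_le (s := Set.univ) (C := 2 * G)
    (f := EE c) (fun x _ => (hasFDerivAt_EE h x).hasFDerivWithinAt) (fun x _ => ?_) convex_univ
    (Set.mem_univ x) (Set.mem_univ (x + y))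
  · simpa using key
  · refine ContinuousLinearMap.opNorm_le_bound _ (by positivity) fun v => ?_
    rw [_root_.sum_apply, Fin.sum_univ_two]
    simp only [ContinuousLinearMap.smulRight_apply, ContinuousLinearMap.proj_apply]
    refine (norm_add_le _ _).trans ?_
    rw [norm_smul, norm_smul]
    have a0 := mul_le_mul (norm_le_pi_norm v 0) (hG 0 x) (norm_nonneg _) (norm_nonneg _)
    have a1 := mul_le_mul (norm_le_pi_norm v 1) (hG 1 x) (norm_nonneg _) (norm_nonneg _)
    linarith

lemma sup_le_grad (h : RD c) (hz : c 0 = 0) {G : ℝ} (hG : ∀ i x, ‖EE (dC i c) x‖ ≤ G) (x : Vd 2) :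
    ‖EE c x‖ ≤ 14 * G := by
  have hG0 : 0 ≤ G := (norm_nonneg _).trans (hG 0 0)
  refine norm_EE_le_of_osc h hz (fun x hx y hy => ?_) x
  have := norm_shC_le_grad h hG (x - y) y
  rw [EE_shC h, add_sub_cancel] at this
  nlinarith [norm_sub_le_box hx hy]

lemma norm_dC_resC_le_gap (h : RD c) (hz : c 0 = 0) {ξ A : ℝ} (hξ : 0 < ξ) (hA : ∀ x, ‖EE c x‖ ≤ A)
    (i : Fin 2) (x : Vd 2) : ‖EE (dC i (resC ξ c)) x‖ ≤ 112 * A := by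
  have hr := h.resC hξ
  set G := ⨆ p : Fin 2 × Vd 2, ‖EE (dC p.1 (resC ξ c)) p.2‖ with hGdef
  have hbdd : BddAbove (Set.range fun p : Fin 2 × Vd 2 => ‖EE (dC p.1 (resC ξ c)) p.2‖) := by
    refine ⟨∑ j : Fin 2, ∑' k, ‖dC j (resC ξ c) k‖, ?_⟩
    rintro _ ⟨p, rfl⟩
    refine (norm_EE_le (hr.dC p.1) p.2).trans ?_
    exact Finset.single_le_sum (f := fun j : Fin 2 => ∑' k, ‖dC j (resC ξ c) k‖)
      (fun _ _ => tsum_nonneg fun _ => norm_nonneg _) (Finset.mem_univ p.1)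
  have hG : ∀ j y, ‖EE (dC j (resC ξ c)) y‖ ≤ G := fun j y => le_ciSup hbdd (j, y)
  have hz' : resC ξ c 0 = 0 := by simp [resC, hz]
  have hstep : G ≤ G / 2 + 56 * A := by
    refine ciSup_le fun p => ?_
    refine (norm_dC_le hr p.1 (M := 28 * G) (δ := 28) (by norm_num) (fun x s _ _ => ?_)
      (norm_lapK_resC_le_sup h hξ hA) p.2).trans (le_of_eq ?_)
    · refine (norm_sub_le _ _).trans ?_
      linarith [sup_le_grad hr hz' hG (x + s • ei p.1), sup_le_grad hr hz' hG (x + (-s) • ei p.1)]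
    · ring
  linarith [hG i x]

lemma min_one_le_rpow {α r : ℝ} (h0 : 0 ≤ α) (h1 : α ≤ 1) (hr : 0 ≤ r) : min 1 r ≤ r ^ α := by
  rcases le_total r 1 with h | h
  · rw [min_eq_right h]
    rcases eq_or_lt_of_le hr with h' | h'
    · rw [← h']; positivity
    · calc r = r ^ (1 : ℝ) := (Real.rpow_one r).symm
        _ ≤ r ^ α := Real.rpow_le_rpow_of_exponent_ge h' h h1
  · rw [min_eq_left h]
    exact Real.one_le_rpow h h0

lemma exists_HB {α : ℝ} (h0 : 0 ≤ α) (h1 : α ≤ 1) (h : RD c) : ∃ A, HB α A c := by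
  obtain ⟨S, hS⟩ : ∃ S, ∀ x, ‖EE c x‖ ≤ S := ⟨_, norm_EE_le h⟩
  obtain ⟨G0, hG0⟩ : ∃ S, ∀ x, ‖EE (dC 0 c) x‖ ≤ S := ⟨_, norm_EE_le (h.dC 0)⟩
  obtain ⟨G1, hG1⟩ : ∃ S, ∀ x, ‖EE (dC 1 c) x‖ ≤ S := ⟨_, norm_EE_le (h.dC 1)⟩
  have hG : ∀ i x, ‖EE (dC i c) x‖ ≤ max G0 G1 := by
    intro i x
    fin_cases i
    · exact (hG0 x).trans (le_max_left _ _)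
    · exact (hG1 x).trans (le_max_right _ _)
  refine ⟨max (2 * S) (2 * max G0 G1), fun y x => ?_⟩
  have b1 := norm_shC_le_grad h hG y x
  have b2 : ‖EE (shC y c) x‖ ≤ 2 * S := by
    rw [EE_shC h]
    exact (norm_sub_le _ _).trans (by linarith [hS x, hS (x + y)])
  have hm := min_one_le_rpow h0 h1 (norm_nonneg y)
  set D := max (2 * S) (2 * max G0 G1)
  have hD : 0 ≤ D := (norm_nonneg _).trans (b2.trans (le_max_left _ _))
  refine le_trans ?_ (mul_le_mul_of_nonneg_left hm hD)
  rcases min_choice 1 ‖y‖ with h' | h' <;> rw [h']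
  · rw [mul_one]; exact b2.trans (le_max_left _ _)
  · exact b1.trans (mul_le_mul_of_nonneg_right (le_max_right _ _) (norm_nonneg _))

end

lemma norm_tsum_le_integral {ι : Type*} [Countable ι] {q : ι → ℝ → ℝ} {Q : ι → ℝ} {a : ι → ℂ}
    {b : ℝ → ℝ}
    (hq : ∀ k, a k ≠ 0 → IntegrableOn (q k) (Set.Ioi 0) ∧ ∫ ξ in Set.Ioi 0, q k ξ = Q k)
    (hq0 : ∀ k, ∀ ξ > 0, 0 ≤ q k ξ)
    (hs : Summable fun k => Q k * ‖a k‖) (hb : IntegrableOn b (Set.Ioi 0))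
    (hle : ∀ ξ > 0, ‖∑' k, (q k ξ : ℂ) * a k‖ ≤ b ξ) :
    ‖∑' k, (Q k : ℂ) * a k‖ ≤ ∫ ξ in Set.Ioi 0, b ξ := by
  have hF : ∀ k, Integrable (fun ξ => (q k ξ : ℂ) * a k) (volume.restrict (Set.Ioi 0)) := by
    intro k
    by_cases h : a k = 0
    · simp [h]
    · exact ((hq k h).1.ofReal).mul_const _
  have hI : ∀ k, ∫ ξ in Set.Ioi 0, (q k ξ : ℂ) * a k = (Q k : ℂ) * a k := by
    intro k
    by_cases h : a k = 0
    · simp [h]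
    · rw [integral_mul_const, integral_complex_ofReal, (hq k h).2]
  have hN : ∀ k, ∫ ξ in Set.Ioi 0, ‖(q k ξ : ℂ) * a k‖ = Q k * ‖a k‖ := by
    intro k
    by_cases h : a k = 0
    · simp [h]
    · rw [← (hq k h).2, ← integral_mul_const]
      refine setIntegral_congr_fun measurableSet_Ioi fun ξ hξ => ?_
      simp only [norm_mul, Complex.norm_real, Real.norm_of_nonneg (hq0 k ξ hξ)]
  have key := hasSum_integral_of_summable_integral_norm hF (by simpa only [hN] using hs)
  simp only [hI] at key
  rw [key.tsum_eq]
  refine norm_integral_le_of_norm_le hb ?_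
  filter_upwards [ae_restrict_mem measurableSet_Ioi] with ξ hξ
  exact hle ξ hξ

lemma integral_cube_kernel {a : ℝ} (ha : 0 < a) :
    IntegrableOn (fun ξ : ℝ => 4 * ξ ^ 3 / (ξ ^ 2 + a) ^ 3) (Set.Ioi 0) ∧
      ∫ ξ in Set.Ioi (0 : ℝ), 4 * ξ ^ 3 / (ξ ^ 2 + a) ^ 3 = 1 / a := by
  have hd : ∀ x : ℝ, HasDerivAt (fun ξ : ℝ => 1 / a * (1 - a / (ξ ^ 2 + a)) ^ 2)
      (4 * x ^ 3 / (x ^ 2 + a) ^ 3) x := by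
    intro x
    have hx : x ^ 2 + a ≠ 0 := by positivity
    have h1 : HasDerivAt (fun ξ : ℝ => ξ ^ 2 + a) (2 * x) x := by
      simpa using ((hasDerivAt_id x).pow 2).add_const a
    have h2 := ((((hasDerivAt_const x a).div h1 hx).const_sub 1).pow 2).const_mul (1 / a)
    refine h2.congr_deriv ?_
    simp
    field_simp
    ring
  have ht : Filter.Tendsto (fun ξ : ℝ => 1 / a * (1 - a / (ξ ^ 2 + a)) ^ 2) Filter.atTop
      (nhds (1 / a)) := by
    have h1 : Filter.Tendsto (fun ξ : ℝ => ξ ^ 2 + a) Filter.atTop Filter.atTop :=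
      Filter.tendsto_atTop_add_const_right _ _ (Filter.tendsto_pow_atTop two_ne_zero)
    have h2 := (((h1.const_div_atTop a).const_sub 1).pow 2).const_mul (1 / a)
    simpa using h2
  have hp : ∀ x ∈ Set.Ioi (0 : ℝ), 0 ≤ 4 * x ^ 3 / (x ^ 2 + a) ^ 3 := fun x hx => by
    have : (0 : ℝ) < x := hx
    positivity
  refine ⟨integrableOn_Ioi_deriv_of_nonneg (hd 0).continuousAt.continuousWithinAt
    (fun x _ => hd x) hp ht, ?_⟩
  rw [integral_Ioi_of_hasDerivAt_of_nonneg (hd 0).continuousAt.continuousWithinAt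
    (fun x _ => hd x) hp ht]
  simp [ha.ne']

lemma hasDerivAt_arctan_div {a : ℝ} (ha : 0 < a) (x : ℝ) :
    HasDerivAt (fun ξ : ℝ => Real.arctan (ξ / a)) (a / (x ^ 2 + a ^ 2)) x := by
  refine (((hasDerivAt_id x).div_const a).arctan).congr_deriv ?_
  have : x ^ 2 + a ^ 2 ≠ 0 := by positivity
  have : 1 + (x / a) ^ 2 ≠ 0 := by positivity
  simp only [id]
  field_simp
  ring

lemma tendsto_arctan_div {a : ℝ} (ha : 0 < a) :
    Filter.Tendsto (fun ξ : ℝ => Real.arctan (ξ / a)) Filter.atTop (nhds (Real.pi / 2)) :=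
  (tendsto_nhds_of_tendsto_nhdsWithin Real.tendsto_arctan_atTop).comp
    (Filter.tendsto_id.atTop_div_const ha)

lemma integral_prod_kernel {a b : ℝ} (ha : 0 < a) (hb : 0 < b) :
    IntegrableOn (fun ξ : ℝ => 2 / Real.pi * ((ξ ^ 2 + a ^ 2)⁻¹ * (ξ ^ 2 + b ^ 2)⁻¹)) (Set.Ioi 0) ∧
      ∫ ξ in Set.Ioi (0 : ℝ), 2 / Real.pi * ((ξ ^ 2 + a ^ 2)⁻¹ * (ξ ^ 2 + b ^ 2)⁻¹)
        = 1 / (a * b * (a + b)) := by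
  have hpi := Real.pi_pos
  have hp : ∀ x ∈ Set.Ioi (0 : ℝ), 0 ≤ 2 / Real.pi * ((x ^ 2 + a ^ 2)⁻¹ * (x ^ 2 + b ^ 2)⁻¹) :=
    fun x hx => by positivity
  obtain ⟨G, h0, hd, ht⟩ : ∃ G : ℝ → ℝ, G 0 = 0 ∧ (∀ x, HasDerivAt G
      (2 / Real.pi * ((x ^ 2 + a ^ 2)⁻¹ * (x ^ 2 + b ^ 2)⁻¹)) x) ∧
      Filter.Tendsto G Filter.atTop (nhds (1 / (a * b * (a + b)))) := by
    rcases eq_or_ne a b with hab | hab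
    · subst hab
      refine ⟨fun ξ => 2 / Real.pi * (ξ / (ξ ^ 2 + a ^ 2) / (2 * a ^ 2)
        + Real.arctan (ξ / a) / (2 * a ^ 3)), by simp, fun x => ?_, ?_⟩
      · have hx : x ^ 2 + a ^ 2 ≠ 0 := by positivity
        have h1 : HasDerivAt (fun ξ : ℝ => ξ ^ 2 + a ^ 2) (2 * x) x := by
          simpa using ((hasDerivAt_id x).pow 2).add_const (a ^ 2)
        refine (((((hasDerivAt_id x).div h1 hx).div_const (2 * a ^ 2)).add
          ((hasDerivAt_arctan_div ha x).div_const (2 * a ^ 3))).const_mul (2 / Real.pi)).congr_deriv ?_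
        simp
        field_simp
        ring
      · have h2 : Filter.Tendsto (fun ξ : ℝ => ξ / (ξ ^ 2 + a ^ 2)) Filter.atTop (nhds 0) := by
          refine squeeze_zero' ?_ ?_ tendsto_inv_atTop_zero
          · filter_upwards [Filter.eventually_gt_atTop 0] with ξ hξ
            positivity
          · filter_upwards [Filter.eventually_gt_atTop 0] with ξ hξ
            rw [div_le_iff₀ (by positivity)]
            field_simp
            nlinarith [sq_nonneg a]
        have h3 := ((h2.div_const (2 * a ^ 2)).add
          ((tendsto_arctan_div ha).div_const (2 * a ^ 3))).const_mul (2 / Real.pi)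
        have e : 2 / Real.pi * (0 / (2 * a ^ 2) + Real.pi / 2 / (2 * a ^ 3)) = 1 / (a * a * (a + a)) := by
          field_simp
          ring
        rwa [e] at h3
    · have hne : b ^ 2 - a ^ 2 ≠ 0 := by
        rw [sq_sub_sq]
        exact mul_ne_zero (by positivity) (sub_ne_zero.2 hab.symm)
      refine ⟨fun ξ => 2 / Real.pi * ((Real.arctan (ξ / a) / a - Real.arctan (ξ / b) / b)
        / (b ^ 2 - a ^ 2)), by simp, fun x => ?_, ?_⟩
      · have hx : x ^ 2 + a ^ 2 ≠ 0 := by positivity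
        have hx' : x ^ 2 + b ^ 2 ≠ 0 := by positivity
        refine (((((hasDerivAt_arctan_div ha x).div_const a).sub
          ((hasDerivAt_arctan_div hb x).div_const b)).div_const (b ^ 2 - a ^ 2)).const_mul
            (2 / Real.pi)).congr_deriv ?_
        field_simp
        ring
      · have h3 := ((((tendsto_arctan_div ha).div_const a).sub
          ((tendsto_arctan_div hb).div_const b)).div_const (b ^ 2 - a ^ 2)).const_mul (2 / Real.pi)
        have e : 2 / Real.pi * ((Real.pi / 2 / a - Real.pi / 2 / b) / (b ^ 2 - a ^ 2))
            = 1 / (a * b * (a + b)) := by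
          have : b ^ 2 - a ^ 2 = (b - a) * (b + a) := by ring
          have h5 : b - a ≠ 0 := sub_ne_zero.2 hab.symm
          rw [this]
          field_simp
          ring
        rwa [e] at h3
  refine ⟨integrableOn_Ioi_deriv_of_nonneg (hd 0).continuousAt.continuousWithinAt
    (fun x _ => hd x) hp ht, ?_⟩
  rw [integral_Ioi_of_hasDerivAt_of_nonneg (hd 0).continuousAt.continuousWithinAt
    (fun x _ => hd x) hp ht, h0, sub_zero]

/-- Integrable majorant interpolating between `r ξ^{-α}` and `ξ^{-α-1}`. -/
def bb (α r ξ : ℝ) : ℝ := if ξ ≤ 1 / r then r * ξ ^ (-α) else ξ ^ (-α - 1)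

lemma integral_bb {α r : ℝ} (h0 : 0 < α) (h1 : α < 1) (hr : 0 < r) :
    IntegrableOn (bb α r) (Set.Ioi 0) ∧
      ∫ ξ in Set.Ioi 0, bb α r ξ = r ^ α * (1 / (1 - α) + 1 / α) := by
  have hr' : 0 < 1 / r := by positivity
  have i1 : IntegrableOn (fun ξ : ℝ => r * ξ ^ (-α)) (Set.Ioc 0 (1 / r)) :=
    ((intervalIntegrable_iff_integrableOn_Ioc_of_le hr'.le).1
      (intervalIntegral.intervalIntegrable_rpow' (by linarith))).const_mul r
  have i2 : IntegrableOn (fun ξ : ℝ => ξ ^ (-α - 1)) (Set.Ioi (1 / r)) :=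
    integrableOn_Ioi_rpow_of_lt (by linarith) hr'
  have e1 : Set.EqOn (bb α r) (fun ξ : ℝ => r * ξ ^ (-α)) (Set.Ioc 0 (1 / r)) := fun ξ hξ => by
    simp only [bb, if_pos hξ.2]
  have e2 : Set.EqOn (bb α r) (fun ξ : ℝ => ξ ^ (-α - 1)) (Set.Ioi (1 / r)) := fun ξ hξ => by
    simp only [bb, if_neg (not_le.2 (Set.mem_Ioi.1 hξ))]
  have j1 := i1.congr_fun e1.symm measurableSet_Ioc
  have j2 := i2.congr_fun e2.symm measurableSet_Ioi
  rw [← Set.Ioc_union_Ioi_eq_Ioi hr'.le]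
  refine ⟨j1.union j2, ?_⟩
  rw [setIntegral_union (Set.Ioc_disjoint_Ioi le_rfl) measurableSet_Ioi j1 j2,
    setIntegral_congr_fun measurableSet_Ioc e1, setIntegral_congr_fun measurableSet_Ioi e2,
    integral_Ioi_rpow_of_lt (by linarith) hr', integral_const_mul,
    ← intervalIntegral.integral_of_le hr'.le, integral_rpow (Or.inl (by linarith)),
    Real.zero_rpow (by linarith)]
  have e3 : (1 / r) ^ (-α - 1 + 1) = r ^ α := by
    rw [sub_add_cancel, one_div, Real.inv_rpow hr.le, Real.rpow_neg hr.le, inv_inv]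
  have e4 : (1 / r) ^ (-α + 1) = r ^ α / r := by
    rw [one_div, Real.inv_rpow hr.le, ← Real.rpow_neg hr.le, neg_add, neg_neg, ← sub_eq_add_neg,
      Real.rpow_sub_one hr.ne']
  rw [e3, e4, sub_add_cancel]
  have : 1 - α ≠ 0 := by linarith
  have : -α + 1 ≠ 0 := by linarith
  rw [show -α + 1 = 1 - α by ring]
  field_simp
  ring

section

variable {c : (Fin 2 → ℤ) → ℂ}

/-- Second-order Riesz transform: symbol `k_i k_j / |k|²`. -/
def tK (i j : Fin 2) (c : (Fin 2 → ℤ) → ℂ) : (Fin 2 → ℤ) → ℂ :=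
  fun k => (((k i * k j / nk k : ℝ)) : ℂ) * c k

lemma nk_pos {k : Fin 2 → ℤ} (h : k ≠ 0) : 0 < nk k := by
  refine lt_of_le_of_ne (nk_nonneg k) fun h' => h ?_
  unfold nk at h'
  have h0 : (k 0 : ℝ) = 0 := by nlinarith [sq_nonneg (k 0 : ℝ), sq_nonneg (k 1 : ℝ)]
  have h1 : (k 1 : ℝ) = 0 := by nlinarith [sq_nonneg (k 0 : ℝ), sq_nonneg (k 1 : ℝ)]
  funext i
  fin_cases i
  · exact_mod_cast h0
  · exact_mod_cast h1

lemma abs_coord_mul_le (k : Fin 2 → ℤ) (i j : Fin 2) : |(k i : ℝ) * k j| ≤ nk k := by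
  unfold nk
  rw [abs_le]
  fin_cases i <;> fin_cases j <;> simp <;> constructor <;>
    nlinarith [sq_nonneg ((k 0 : ℝ) - k 1), sq_nonneg ((k 0 : ℝ) + k 1), sq_nonneg (k 0 : ℝ),
      sq_nonneg (k 1 : ℝ)]

lemma RD.tK (h : RD c) (i j : Fin 2) : RD (tK i j c) := by
  refine h.mul_of_bound 1 0 fun k => ?_
  rw [Complex.norm_real, Real.norm_eq_abs, abs_div, abs_of_nonneg (nk_nonneg k), pow_zero, mul_one]
  exact div_le_one_of_le₀ (abs_coord_mul_le k i j) (nk_nonneg k)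

lemma HB.tK {α B : ℝ} (h0 : 0 < α) (h1 : α < 1) (h : RD c) (hc : HB α B c) (i j : Fin 2) :
    HB α (432 * (1 / (1 - α) + 1 / α) * B) (tK i j c) := by
  intro y x
  have hB := hc.nonneg
  rcases eq_or_ne y 0 with rfl | hy
  · rw [EE_shC (h.tK i j)]
    simp only [add_zero, sub_self, norm_zero]
    have : 0 < 1 - α := by linarith
    positivity
  have hr : 0 < ‖y‖ := norm_pos_iff.2 hy
  set a : (Fin 2 → ℤ) → ℂ := fun k => ((k i * k j : ℝ) : ℂ) * shC y c k * ee k x with ha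
  have ha0 : a 0 = 0 := by simp [ha]
  have hmul : RD fun k => ((k i * k j : ℝ) : ℂ) * shC y c k := by
    refine (h.shC y).mul_of_bound 2 2 fun k => ?_
    rw [Complex.norm_real, Real.norm_eq_abs]
    exact (abs_coord_mul_le k i j).trans (nk_le k)
  have hbb := integral_bb h0 h1 hr
  have e : EE (shC y (_root_.tK i j c)) x = ∑' k, ((1 / nk k : ℝ) : ℂ) * a k := by
    unfold EE
    refine tsum_congr fun k => ?_
    simp only [ha, shC, _root_.tK]
    push_cast
    ring
  rw [e]
  have key := norm_tsum_le_integral (q := fun k ξ => 4 * ξ ^ 3 / (ξ ^ 2 + nk k) ^ 3)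
    (Q := fun k => 1 / nk k) (a := a) (b := fun ξ => 432 * B * bb α ‖y‖ ξ) ?_ ?_ ?_
    (hbb.1.const_mul _) ?_
  · refine key.trans (le_of_eq ?_)
    rw [integral_const_mul, hbb.2]
    ring
  · intro k hk
    exact integral_cube_kernel (nk_pos fun h => hk (h ▸ ha0))
  · intro k ξ hξ
    have := nk_nonneg k
    positivity
  · refine Summable.of_nonneg_of_le (fun k => by have := nk_nonneg k; positivity) (fun k => ?_)
      hmul.summable_norm
    simp only [ha, norm_mul _ (ee k x), norm_ee, mul_one]
    rcases eq_or_ne k 0 with rfl | hk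
    · simp
    · have h2 : 1 ≤ nk k := by
        have := nk_pos hk
        have e : nk k = (((k 0) ^ 2 + (k 1) ^ 2 : ℤ) : ℝ) := by unfold nk; push_cast; ring
        rw [e] at this ⊢
        exact_mod_cast this
      refine mul_le_of_le_one_left (norm_nonneg _) ?_
      rw [div_le_one (by linarith)]
      exact h2
  · intro ξ hξ
    have hξ' : 0 < ξ := hξ
    set c1 := dC j (_root_.resC ξ c) with hc1
    have r1 : RD c1 := (h.resC hξ').dC j
    set c2 := dC i (_root_.resC ξ c1) with hc2
    have r2 : RD c2 := (r1.resC hξ').dC i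
    set c3 := _root_.resC ξ c2 with hc3
    have r3 : RD c3 := r2.resC hξ'
    have b1 := norm_dC_resC_le_holder h h0.le h1.le hξ' hc j
    have b2 := norm_dC_resC_le r1 hξ' b1 i
    have b3 := norm_resC_le r2 hξ' b2
    have g3 := fun p => norm_dC_resC_le r2 hξ' b2 p
    have s1 : ‖EE (shC y c3) x‖ ≤ 2 * (3 * (6 * B * ξ ^ (-α) / ξ) / ξ / ξ ^ 2) := by
      rw [EE_shC r3]
      exact (norm_sub_le _ _).trans (by linarith [b3 x, b3 (x + y)])
    have s2 := norm_shC_le_grad r3 (fun p x => g3 p x) y x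
    have e2 : ∑' k, ((4 * ξ ^ 3 / (ξ ^ 2 + nk k) ^ 3 : ℝ) : ℂ) * a k
        = ((-4 * ξ ^ 3 : ℝ) : ℂ) * EE (shC y c3) x := by
      unfold EE
      rw [← tsum_mul_left]
      refine tsum_congr fun k => ?_
      simp only [ha, hc3, hc2, hc1, shC, _root_.resC, dC]
      have hI := Complex.I_sq
      have : ((ξ ^ 2 + nk k : ℝ) : ℂ) ≠ 0 := by
        have := nk_nonneg k
        exact_mod_cast (by positivity : ξ ^ 2 + nk k ≠ 0)
      push_cast at this ⊢
      field_simp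
      rw [hI]
      ring
    rw [e2, norm_mul, Complex.norm_real, norm_mul, norm_pow, norm_neg, Real.norm_of_nonneg hξ'.le]
    rw [Real.norm_of_nonneg (by norm_num : (0 : ℝ) ≤ 4)]
    unfold bb
    split_ifs with hif
    · refine (mul_le_mul_of_nonneg_left s2 (by positivity)).trans (le_of_eq ?_)
      field_simp
      ring
    · refine (mul_le_mul_of_nonneg_left s1 (by positivity)).trans ?_
      rw [Real.rpow_sub_one hξ'.ne']
      have : 4 * ξ ^ 3 * (2 * (3 * (6 * B * ξ ^ (-α) / ξ) / ξ / ξ ^ 2))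
        = 144 * B * (ξ ^ (-α) / ξ) := by
        field_simp
        ring
      rw [this]
      gcongr
      norm_num

end

section

variable {c : (Fin 2 → ℤ) → ℂ}

/-- Bilinear Fourier multiplier with symbol `M`, acting on coefficient sequences. -/
def Bil (M : (Fin 2 → ℤ) → (Fin 2 → ℤ) → ℂ) (c d : (Fin 2 → ℤ) → ℂ) : (Fin 2 → ℤ) → ℂ :=
  fun m => ∑' k, M k (m - k) * c k * d (m - k)

/-- Symbols of at most polynomial growth. -/
def PolyB (M : (Fin 2 → ℤ) → (Fin 2 → ℤ) → ℂ) : Prop :=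
  ∃ (C : ℝ) (p : ℕ), ∀ k l, ‖M k l‖ ≤ C * (om k ^ p * om l ^ p)

/-- The reindexing `(m, k) ↦ (k, m - k)`. -/
def freqEquiv : ((Fin 2 → ℤ) × (Fin 2 → ℤ)) ≃ ((Fin 2 → ℤ) × (Fin 2 → ℤ)) where
  toFun p := (p.2, p.1 - p.2)
  invFun q := (q.1 + q.2, q.1)
  left_inv p := by simp
  right_inv q := by simp

section
variable {d : (Fin 2 → ℤ) → ℂ} {M : (Fin 2 → ℤ) → (Fin 2 → ℤ) → ℂ}

lemma PolyB.summable (hM : PolyB M) (hc : RD c) (hd : RD d) (n : ℕ) :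
    Summable fun p : (Fin 2 → ℤ) × (Fin 2 → ℤ) =>
      om p.1 ^ n * om p.2 ^ n * ‖M p.1 p.2 * c p.1 * d p.2‖ := by
  obtain ⟨C, q, hM⟩ := hM
  have hs := (hc (n + q)).mul_of_nonneg (hd (n + q))
    (fun k => by have := om_pos k; positivity) (fun k => by have := om_pos k; positivity)
  refine Summable.of_nonneg_of_le (fun p => ?_) (fun p => ?_) (hs.mul_left C)
  · have := om_pos p.1
    have := om_pos p.2
    positivity
  · have h1 := om_pos p.1
    have h2 := om_pos p.2
    rw [norm_mul, norm_mul]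
    calc om p.1 ^ n * om p.2 ^ n * (‖M p.1 p.2‖ * ‖c p.1‖ * ‖d p.2‖)
        ≤ om p.1 ^ n * om p.2 ^ n * (C * (om p.1 ^ q * om p.2 ^ q) * ‖c p.1‖ * ‖d p.2‖) := by
          gcongr
          exact hM _ _
      _ = _ := by ring

lemma RD.Bil (hM : PolyB M) (hc : RD c) (hd : RD d) : RD (Bil M c d) := by
  intro n
  have hs := freqEquiv.summable_iff.2 (hM.summable hc hd n)
  refine Summable.of_nonneg_of_le (fun k => by have := om_pos k; positivity) (fun m => ?_) hs.prod
  have hf := hs.prod_factor m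
  have hf0 : Summable fun k => ‖M k (m - k) * c k * d (m - k)‖ := by
    refine Summable.of_nonneg_of_le (fun k => norm_nonneg _) (fun k => ?_) hf
    have h1 := one_le_om k
    have h2 := one_le_om (m - k)
    refine le_mul_of_one_le_left (norm_nonneg _) ?_
    exact one_le_mul_of_one_le_of_one_le (one_le_pow₀ h1) (one_le_pow₀ h2)
  refine (mul_le_mul_of_nonneg_left (norm_tsum_le_tsum_norm hf0)
    (by have := om_pos m; positivity)).trans ?_
  rw [← tsum_mul_left]
  refine Summable.tsum_le_tsum (fun k => ?_) (hf0.mul_left _) hf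
  refine mul_le_mul_of_nonneg_right ?_ (norm_nonneg _)
  rw [← mul_pow]
  have := om_pos m
  have h := om_add_le k (m - k)
  rw [add_sub_cancel] at h
  exact pow_le_pow_left₀ this.le h n

lemma summable_Bil (hM : PolyB M) (hc : RD c) (hd : RD d) (x : Vd 2) :
    Summable fun p : (Fin 2 → ℤ) × (Fin 2 → ℤ) =>
      M p.1 p.2 * c p.1 * d p.2 * (ee p.1 x * ee p.2 x) := by
  refine Summable.of_norm ?_
  refine (hM.summable hc hd 0).congr fun p => ?_
  rw [norm_mul _ (ee p.1 x * ee p.2 x), norm_mul (ee p.1 x), norm_ee, norm_ee]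
  simp

lemma EE_Bil (hM : PolyB M) (hc : RD c) (hd : RD d) (x : Vd 2) :
    EE (Bil M c d) x = ∑' p : (Fin 2 → ℤ) × (Fin 2 → ℤ),
      M p.1 p.2 * c p.1 * d p.2 * (ee p.1 x * ee p.2 x) := by
  have hs := summable_Bil hM hc hd x
  rw [← freqEquiv.tsum_eq]
  refine Eq.trans ?_ (freqEquiv.summable_iff.2 hs).tsum_prod.symm
  unfold EE Bil
  refine tsum_congr fun m => ?_
  rw [← tsum_mul_right]
  refine tsum_congr fun k => ?_
  simp only [freqEquiv, Equiv.coe_fn_mk, Function.comp]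
  rw [← ee_add_left, add_sub_cancel]

lemma EE_mul_EE (hc : RD c) (hd : RD d) (x : Vd 2) :
    EE c x * EE d x = ∑' p : (Fin 2 → ℤ) × (Fin 2 → ℤ), c p.1 * d p.2 * (ee p.1 x * ee p.2 x) := by
  unfold EE
  rw [tsum_mul_tsum_of_summable_norm]
  · refine tsum_congr fun p => ?_
    ring
  · simpa [norm_mul, norm_ee] using hc.summable_norm
  · simpa [norm_mul, norm_ee] using hd.summable_norm

lemma PolyB.one : PolyB fun _ _ => 1 := ⟨1, 0, fun k l => by simp⟩

lemma EE_Bil_one (hc : RD c) (hd : RD d) (x : Vd 2) :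
    EE (Bil (fun _ _ => 1) c d) x = EE c x * EE d x := by
  rw [EE_Bil PolyB.one hc hd, EE_mul_EE hc hd]
  simp

end

/-- The symbol `|k|² k_j l_i / (|k| |l| (|k| + |l|))`. -/
def qS (j i : Fin 2) (k l : Fin 2 → ℤ) : ℝ :=
  1 / (√(nk k) * √(nk l) * (√(nk k) + √(nk l))) * (nk k * k j * l i)

lemma one_le_nk {k : Fin 2 → ℤ} (hk : k ≠ 0) : 1 ≤ nk k := by
  have := nk_pos hk
  have e : nk k = (((k 0) ^ 2 + (k 1) ^ 2 : ℤ) : ℝ) := by unfold nk; push_cast; ring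
  rw [e] at this ⊢
  exact_mod_cast this

lemma nk_zero : nk 0 = 0 := by simp [nk]

lemma qS_kernel_le_one (k l : Fin 2 → ℤ) :
    1 / (√(nk k) * √(nk l) * (√(nk k) + √(nk l))) ≤ 1 := by
  rcases eq_or_ne k 0 with rfl | hk
  · simp [nk_zero]
  rcases eq_or_ne l 0 with rfl | hl
  · simp [nk_zero]
  have h1 : 1 ≤ √(nk k) := Real.one_le_sqrt.2 (one_le_nk hk)
  have h2 : 1 ≤ √(nk l) := Real.one_le_sqrt.2 (one_le_nk hl)
  rw [div_le_one (by positivity)]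
  have := one_le_mul_of_one_le_of_one_le h1 h2
  nlinarith

lemma PolyB.qS (j i : Fin 2) : PolyB fun k l => (_root_.qS j i k l : ℂ) := by
  refine ⟨2, 3, fun k l => ?_⟩
  have h1 := one_le_om k
  have h2 := one_le_om l
  unfold _root_.qS
  rw [Complex.norm_real, norm_mul, Real.norm_of_nonneg (by positivity)]
  refine (mul_le_of_le_one_left (norm_nonneg _) (qS_kernel_le_one k l)).trans ?_
  rw [norm_mul, norm_mul, Real.norm_of_nonneg (nk_nonneg k), Real.norm_eq_abs, Real.norm_eq_abs]
  have a1 := nk_le k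
  have a2 := abs_coord_le_om k j
  have a3 : |(l i : ℝ)| ≤ om l ^ 3 := (abs_coord_le_om l i).trans (le_self_pow₀ h2 (by norm_num))
  calc nk k * |(k j : ℝ)| * |(l i : ℝ)| ≤ 2 * om k ^ 2 * om k * om l ^ 3 := by gcongr
    _ = _ := by ring

/-- The Hölder constant produced by the kernel integral. -/
def kA (α : ℝ) : ℝ := 1 / (1 - α) + 1 / α

lemma kA_pos {α : ℝ} (h0 : 0 < α) (h1 : α < 1) : 0 < kA α := by
  unfold kA
  have : 0 < 1 - α := by linarith
  positivity

lemma holder_Bil_qS {α A B : ℝ} {d : (Fin 2 → ℤ) → ℂ} (h0 : 0 < α) (h1 : α < 1) (hc : RD c) (hd : RD d)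
    (hd0 : d 0 = 0) (j i : Fin 2) (hA : HB α A (dC j c)) (hB : HB α B d) :
    HB α (3136 * kA α * (A * B)) (Bil (fun k l => (qS j i k l : ℂ)) c d) := by
  intro y x
  have hA0 := hA.nonneg
  have hB0 := hB.nonneg
  have hP := PolyB.qS j i
  have hK := kA_pos h0 h1
  rw [EE_shC (RD.Bil hP hc hd), EE_Bil hP hc hd, EE_Bil hP hc hd,
    ← (summable_Bil hP hc hd _).tsum_sub (summable_Bil hP hc hd _)]
  set a : (Fin 2 → ℤ) × (Fin 2 → ℤ) → ℂ := fun p =>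
    ((nk p.1 * p.1 j * p.2 i : ℝ) : ℂ) * c p.1 * d p.2 *
      (ee p.1 (x + y) * ee p.2 (x + y) - ee p.1 x * ee p.2 x) with ha
  have hbb := integral_bb h0 h1 one_pos
  have e : ∀ p : (Fin 2 → ℤ) × (Fin 2 → ℤ),
      (qS j i p.1 p.2 : ℂ) * c p.1 * d p.2 * (ee p.1 (x + y) * ee p.2 (x + y)) -
      (qS j i p.1 p.2 : ℂ) * c p.1 * d p.2 * (ee p.1 x * ee p.2 x) =
      ((1 / (√(nk p.1) * √(nk p.2) * (√(nk p.1) + √(nk p.2))) : ℝ) : ℂ) * a p := by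
    intro p
    simp only [ha, qS]
    push_cast
    ring
  simp only [e]
  have hdj : RD (dC j c) := hc.dC j
  have supA := HB.sup_le h0.le h1.le hA hdj (by simp [dC])
  have supB := HB.sup_le h0.le h1.le hB hd hd0
  have key := norm_tsum_le_integral
    (q := fun p ξ => 2 / Real.pi * ((ξ ^ 2 + √(nk p.1) ^ 2)⁻¹ * (ξ ^ 2 + √(nk p.2) ^ 2)⁻¹))
    (Q := fun p : (Fin 2 → ℤ) × (Fin 2 → ℤ) =>
      1 / (√(nk p.1) * √(nk p.2) * (√(nk p.1) + √(nk p.2)))) (a := a)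
    (b := fun ξ => 3136 * (A * B) * ‖y‖ ^ α * bb α 1 ξ) ?_ ?_ ?_
    (hbb.1.const_mul _) ?_
  · refine key.trans (le_of_eq ?_)
    rw [integral_const_mul, hbb.2, Real.one_rpow]
    unfold kA
    ring
  · intro p hp
    have hk : p.1 ≠ 0 := fun h => hp (by simp [ha, h, nk_zero])
    have hl : p.2 ≠ 0 := fun h => hp (by simp [ha, h])
    exact integral_prod_kernel (Real.sqrt_pos.2 (nk_pos hk)) (Real.sqrt_pos.2 (nk_pos hl))
  · intro p ξ hξ
    have := Real.pi_pos
    positivity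
  · have hs := (hdj.lapK.summable_norm.mul_of_nonneg (hd.dC i).summable_norm
      (fun _ => norm_nonneg _) (fun _ => norm_nonneg _)).mul_left 2
    refine Summable.of_nonneg_of_le (fun p => by positivity) (fun p => ?_) hs
    refine (mul_le_of_le_one_left (norm_nonneg _) (qS_kernel_le_one _ _)).trans ?_
    simp only [ha, norm_mul]
    have : ‖ee p.1 (x + y) * ee p.2 (x + y) - ee p.1 x * ee p.2 x‖ ≤ 2 := by
      refine (norm_sub_le _ _).trans ?_
      simp only [norm_mul, norm_ee]
      norm_num
    refine (mul_le_mul_of_nonneg_left this (by positivity)).trans (le_of_eq ?_)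
    simp only [lapK, dC, norm_mul, norm_neg, Complex.norm_real, Complex.norm_I,
      Complex.norm_intCast, Real.norm_eq_abs]
    ring
  · intro ξ hξ
    have hξ' : 0 < ξ := hξ
    set u := lapK (resC ξ (dC j c)) with hu
    set v := dC i (resC ξ d) with hv
    have ru : RD u := (hdj.resC hξ').lapK
    have rv : RD v := (hd.resC hξ').dC i
    have e2 : ∑' p, ((2 / Real.pi * ((ξ ^ 2 + √(nk p.1) ^ 2)⁻¹ * (ξ ^ 2 + √(nk p.2) ^ 2)⁻¹) : ℝ) : ℂ)
        * a p = ((2 / Real.pi : ℝ) : ℂ) * (EE u (x + y) * EE v (x + y) - EE u x * EE v x) := by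
      have s := fun z => summable_Bil PolyB.one ru rv z
      simp only [one_mul] at s
      rw [EE_mul_EE ru rv, EE_mul_EE ru rv, ← (s _).tsum_sub (s _), ← tsum_mul_left]
      refine tsum_congr fun p => ?_
      rw [Real.sq_sqrt (nk_nonneg _), Real.sq_sqrt (nk_nonneg _)]
      simp only [ha, hu, hv, lapK, dC, resC]
      push_cast
      linear_combination (2 / (Real.pi : ℂ) * ((ξ : ℂ) ^ 2 + (nk p.1 : ℂ))⁻¹ * ((ξ : ℂ) ^ 2 + (nk p.2 : ℂ))⁻¹ *
        (nk p.1) * (p.1 j) * (p.2 i) * c p.1 * d p.2 * (ee p.1 (x + y) * ee p.2 (x + y) - ee p.1 x * ee p.2 x)) * Complex.I_sq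
    rw [e2, norm_mul, Complex.norm_real, Real.norm_of_nonneg (by positivity)]
    have hpi : 2 / Real.pi ≤ 1 := by
      rw [div_le_one Real.pi_pos]
      linarith [Real.pi_gt_three]
    refine (mul_le_of_le_one_left (norm_nonneg _) hpi).trans ?_
    have du : ‖EE u (x + y) - EE u x‖ ≤ 2 * A * ‖y‖ ^ α := by
      rw [← EE_shC ru]
      exact HB.lapK_resC hA hdj hξ' y x
    have split : ‖EE u (x + y) * EE v (x + y) - EE u x * EE v x‖ ≤
        ‖EE u (x + y) - EE u x‖ * ‖EE v (x + y)‖ + ‖EE u x‖ * ‖EE v (x + y) - EE v x‖ := by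
      rw [← norm_mul, ← norm_mul]
      refine le_trans (le_of_eq ?_) (norm_add_le _ _)
      congr 1
      ring
    refine split.trans ?_
    unfold bb
    split_ifs with hif
    · have vs := norm_dC_resC_le_gap hd hd0 hξ' supB i (x + y)
      have us := norm_lapK_resC_le_sup hdj hξ' supA x
      have dv : ‖EE v (x + y) - EE v x‖ ≤ 112 * (B * ‖y‖ ^ α) := by
        rw [← EE_shC rv, hv, shC_dC, shC_resC]
        exact norm_dC_resC_le_gap (hd.shC y) (by simp [shC, hd0]) hξ' (fun z => hB y z) i x
      have h1ξ : 1 ≤ ξ ^ (-α) := by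
        refine Real.one_le_rpow_of_pos_of_le_one_of_nonpos hξ' ?_ (by linarith)
        simpa using hif
      have hy : 0 ≤ ‖y‖ ^ α := by positivity
      calc _ ≤ 2 * A * ‖y‖ ^ α * (112 * (7 * B)) + 2 * (7 * A) * (112 * (B * ‖y‖ ^ α)) := by
            gcongr
        _ = 3136 * (A * B) * ‖y‖ ^ α * 1 := by ring
        _ ≤ _ := by
            gcongr
            simpa using h1ξ
    · have vs := norm_dC_resC_le_holder hd h0.le h1.le hξ' hB i (x + y)
      have us := norm_lapK_resC_le hdj h0.le h1.le hξ' hA0 hA x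
      have dv : ‖EE v (x + y) - EE v x‖ ≤ 3 * B / ξ * ‖y‖ ^ α := by
        rw [← EE_shC rv]
        exact HB.dC_resC hB hd hξ' i y x
      have hy : 0 ≤ ‖y‖ ^ α := by positivity
      calc _ ≤ 2 * A * ‖y‖ ^ α * (6 * B * ξ ^ (-α) / ξ) + 5 * A * ξ ^ (-α) * (3 * B / ξ * ‖y‖ ^ α) := by
            gcongr
        _ = 27 * (A * B) * ‖y‖ ^ α * (ξ ^ (-α) / ξ) := by ring
        _ ≤ _ := by
            rw [Real.rpow_sub_one hξ'.ne']
            gcongr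
            norm_num

end

section

variable {c : (Fin 2 → ℤ) → ℂ}

section
variable {d : (Fin 2 → ℤ) → ℂ} {M : (Fin 2 → ℤ) → (Fin 2 → ℤ) → ℂ}

lemma PolyB.hasSum_Bil (hM : PolyB M) (hc : RD c) (hd : RD d) (m : Fin 2 → ℤ) :
    HasSum (fun k => M k (m - k) * c k * d (m - k)) (Bil M c d m) := by
  refine Summable.hasSum (Summable.of_norm ?_)
  have hs := freqEquiv.summable_iff.2 (hM.summable hc hd 0)
  refine (hs.prod_factor m).congr fun k => ?_
  simp [freqEquiv]

lemma dC_Bil (hM : PolyB M) (hc : RD c) (hd : RD d) (p : Fin 2) (m : Fin 2 → ℤ) :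
    dC p (Bil M c d) m = Bil M (dC p c) d m + Bil M c (dC p d) m := by
  have h1 := (hM.hasSum_Bil hc hd m).mul_left (Complex.I * (m p : ℂ))
  have h2 := (hM.hasSum_Bil (hc.dC p) hd m).add (hM.hasSum_Bil hc (hd.dC p) m)
  refine h1.unique (h2.congr_fun ?_)
  intro k
  simp only [dC, Pi.sub_apply]
  push_cast
  ring

end

/-- The bilinear multiplier of `S`, decomposed through `qS` and second-order Riesz transforms. -/
def sC (c d : (Fin 2 → ℤ) → ℂ) : (Fin 2 → ℤ) → ℂ := fun m =>
  ((2 * (tK 0 0 (Bil (fun k l => (qS 0 1 k l : ℂ)) c d) m) +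
    2 * (tK 0 1 (Bil (fun k l => (qS 1 1 k l : ℂ)) c d) m)) +
  ((-2) * (tK 1 0 (Bil (fun k l => (qS 0 0 k l : ℂ)) c d) m) +
    (-2) * (tK 1 1 (Bil (fun k l => (qS 1 0 k l : ℂ)) c d) m))) +
  (Bil (fun k l => (qS 1 0 k l : ℂ)) c d m + (-1) * Bil (fun k l => (qS 0 1 k l : ℂ)) c d m)

lemma HB.add {α A B : ℝ} {d : (Fin 2 → ℤ) → ℂ} (hc : RD c) (hd : RD d) (hA : HB α A c)
    (hB : HB α B d) : HB α (A + B) (fun k => c k + d k) := by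
  intro y x
  have e : shC y (fun k => c k + d k) = fun k => shC y c k + shC y d k := by
    funext k; unfold shC; ring
  rw [e, EE_add (hc.shC y) (hd.shC y)]
  refine (norm_add_le _ _).trans ?_
  linarith [hA y x, hB y x]

lemma HB.const_mul {α A : ℝ} (z : ℂ) (hA : HB α A c) : HB α (‖z‖ * A) (fun k => z * c k) := by
  intro y x
  rw [shC_mul, EE_const_mul, norm_mul, mul_assoc]
  exact mul_le_mul_of_nonneg_left (hA y x) (norm_nonneg _)

lemma RD.sC {d : (Fin 2 → ℤ) → ℂ} (hc : RD c) (hd : RD d) : RD (sC c d) := by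
  have q := fun j i => RD.Bil (PolyB.qS j i) hc hd
  exact (((((q 0 1).tK 0 0).const_mul 2).add (((q 1 1).tK 0 1).const_mul 2)).add
    ((((q 0 0).tK 1 0).const_mul (-2)).add (((q 1 0).tK 1 1).const_mul (-2)))).add
    ((q 1 0).add ((q 0 1).const_mul (-1)))

/-- The constant in the zeroth-order estimate. -/
def kS (α : ℝ) : ℝ := 3136 * kA α * (3456 * kA α + 2)

lemma holder_sC {α A B : ℝ} {d : (Fin 2 → ℤ) → ℂ} (h0 : 0 < α) (h1 : α < 1) (hc : RD c) (hd : RD d)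
    (hd0 : d 0 = 0) (hA : ∀ j, HB α A (dC j c)) (hB : HB α B d) :
    HB α (kS α * (A * B)) (sC c d) := by
  have q := fun j i => RD.Bil (PolyB.qS j i) hc hd
  have b := fun j i => holder_Bil_qS h0 h1 hc hd hd0 j i (hA j) hB
  have t := fun j i p r => HB.tK h0 h1 (q j i) (b j i) p r
  have := (((((t 0 1 0 0).const_mul 2).add (((q 0 1).tK 0 0).const_mul 2)
    (((q 1 1).tK 0 1).const_mul 2) ((t 1 1 0 1).const_mul 2)).add
    ((((q 0 1).tK 0 0).const_mul 2).add (((q 1 1).tK 0 1).const_mul 2))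
    ((((q 0 0).tK 1 0).const_mul (-2)).add (((q 1 0).tK 1 1).const_mul (-2)))
    (((t 0 0 1 0).const_mul (-2)).add (((q 0 0).tK 1 0).const_mul (-2))
      (((q 1 0).tK 1 1).const_mul (-2)) ((t 1 0 1 1).const_mul (-2)))).add
    (((((q 0 1).tK 0 0).const_mul 2).add (((q 1 1).tK 0 1).const_mul 2)).add
    ((((q 0 0).tK 1 0).const_mul (-2)).add (((q 1 0).tK 1 1).const_mul (-2))))
    ((q 1 0).add ((q 0 1).const_mul (-1)))
    ((b 1 0).add (q 1 0) ((q 0 1).const_mul (-1)) ((b 0 1).const_mul (-1))))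
  refine HB.mono this (le_of_eq ?_)
  simp only [norm_neg, norm_one, Complex.norm_ofNat, kS]
  unfold kA
  ring

lemma dC_sC {d : (Fin 2 → ℤ) → ℂ} (hc : RD c) (hd : RD d) (p : Fin 2) :
    dC p (sC c d) = fun m => sC (dC p c) d m + sC c (dC p d) m := by
  funext m
  have h := fun j i => dC_Bil (PolyB.qS j i) hc hd p m
  simp only [dC] at h
  simp only [dC, sC, tK]
  linear_combination 2 * ((m 0 * m 0 / nk m : ℝ) : ℂ) * h 0 1 + 2 * ((m 0 * m 1 / nk m : ℝ) : ℂ) * h 1 1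
    - 2 * ((m 1 * m 0 / nk m : ℝ) : ℂ) * h 0 0 - 2 * ((m 1 * m 1 / nk m : ℝ) : ℂ) * h 1 0 + h 1 0 - h 0 1

/-- The symbol of the `i`-th component of `∇^⊥Λ⁻¹`. -/
def rS (i : Fin 2) (k : Fin 2 → ℤ) : ℂ :=
  if k = 0 then 0 else
    (if i = 0 then -(Complex.I * (k 1 : ℂ)) else Complex.I * (k 0 : ℂ)) / ((kAbs k : ℝ) : ℂ)

lemma kAbs_eq (k : Fin 2 → ℤ) : kAbs k = √(nk k) := by
  simp [kAbs, eNorm, nk]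

lemma norm_rS_le (i : Fin 2) (k : Fin 2 → ℤ) : ‖rS i k‖ ≤ om k := by
  unfold rS
  split_ifs with h hi
  · simp [(om_pos k).le]
  all_goals
    have h1 : 1 ≤ √(nk k) := Real.one_le_sqrt.2 (one_le_nk h)
    rw [norm_div, Complex.norm_real, kAbs_eq, Real.norm_of_nonneg (by positivity)]
    refine (div_le_self (norm_nonneg _) h1).trans ?_
    simpa using abs_coord_le_om k _

lemma sqgOp_EE (h : RD c) (i : Fin 2) : sqgOp i (EE c) = EE fun k => rS i k * c k := by
  unfold sqgOp fmul
  rw [fCoeff_EE h]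
  rfl

lemma RD.rS (h : RD c) (i : Fin 2) : RD fun k => rS i k * c k :=
  h.mul_of_bound 1 1 fun k => by simpa using norm_rS_le i k

lemma lapC_EE (h : RD c) : lapC (EE c) = EE (lapK c) := by
  funext x
  rw [EE_lapK h]
  unfold lapC
  rw [Fin.sum_univ_two]
  have : ∀ i, (fun y => pd i (EE c) y) = EE (dC i c) := fun i => pd_EE h i
  simp only [this, pd_EE (h.dC _)]

lemma divC_EE {v : Fin 2 → (Fin 2 → ℤ) → ℂ} (h : ∀ i, RD (v i)) :
    divC (fun y i => EE (v i) y) = EE fun k => dC 0 (v 0) k + dC 1 (v 1) k := by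
  funext x
  rw [EE_add ((h 0).dC 0) ((h 1).dC 1)]
  unfold divC
  rw [Fin.sum_univ_two]
  have : ∀ i, (fun y => EE (v i) y) = EE (v i) := fun i => rfl
  simp only [this, pd_EE (h _)]

lemma LapInv_EE (h : RD c) : LapInv (EE c) = EE fun k => -((nk k : ℝ) : ℂ)⁻¹ * c k := by
  unfold LapInv fmul
  rw [fCoeff_EE h]
  funext x
  unfold EE
  refine tsum_congr fun k => ?_
  change _ = -((nk k : ℝ) : ℂ)⁻¹ * c k * ee k x
  unfold ee
  congr 2
  beta_reduce
  split_ifs with hk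
  · simp [hk, nk_zero]
  · rw [kAbs_eq, Real.sq_sqrt (nk_nonneg k)]

lemma symbol_identity (k l : Fin 2 → ℤ) (hm : k + l ≠ 0) :
    -((nk (k + l) : ℝ) : ℂ)⁻¹ *
      (Complex.I * ((k + l) 0 : ℤ) * (rS 0 k * -(nk k : ℂ) + -(nk k : ℂ) * rS 0 l) +
      Complex.I * ((k + l) 1 : ℤ) * (rS 1 k * -(nk k : ℂ) + -(nk k : ℂ) * rS 1 l)) =
    ((2 * (((k + l) 0 * (k + l) 0 / nk (k + l) : ℝ) * qS 0 1 k l) +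
      2 * (((k + l) 0 * (k + l) 1 / nk (k + l) : ℝ) * qS 1 1 k l)) +
    ((-2) * (((k + l) 1 * (k + l) 0 / nk (k + l) : ℝ) * qS 0 0 k l) +
      (-2) * (((k + l) 1 * (k + l) 1 / nk (k + l) : ℝ) * qS 1 0 k l))) +
    (qS 1 0 k l + (-1) * qS 0 1 k l) := by
  rcases eq_or_ne k 0 with rfl | hk
  · simp [nk_zero, qS]
  rcases eq_or_ne l 0 with rfl | hl
  · simp only [qS, rS, hk, if_false, nk_zero]
    simp
    right
    ring
  have hn := (nk_pos hm).ne'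
  have ha : √(nk k) ≠ 0 := (Real.sqrt_pos.2 (nk_pos hk)).ne'
  have hb : √(nk l) ≠ 0 := (Real.sqrt_pos.2 (nk_pos hl)).ne'
  have hab : √(nk k) + √(nk l) ≠ 0 := by
    have := Real.sqrt_pos.2 (nk_pos hk)
    have := Real.sqrt_pos.2 (nk_pos hl)
    positivity
  have ea : √(nk k) ^ 2 = (k 0 : ℝ) ^ 2 + (k 1 : ℝ) ^ 2 := Real.sq_sqrt (nk_nonneg k)
  have eb : √(nk l) ^ 2 = (l 0 : ℝ) ^ 2 + (l 1 : ℝ) ^ 2 := Real.sq_sqrt (nk_nonneg l)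
  have en : nk (k + l) = ((k 0 : ℝ) + l 0) ^ 2 + ((k 1 : ℝ) + l 1) ^ 2 := by
    simp [nk]
  simp only [rS, hk, hl, if_false, if_true, one_ne_zero, qS, kAbs_eq, Pi.add_apply]
  have ek : nk k = √(nk k) ^ 2 := (Real.sq_sqrt (nk_nonneg k)).symm
  set a := √(nk k)
  set b := √(nk l)
  set n := nk (k + l)
  rw [ek]
  have hI := Complex.I_sq
  have hn' : (n : ℂ) ≠ 0 := by exact_mod_cast hn
  have ha' : (a : ℂ) ≠ 0 := by exact_mod_cast ha
  have hb' : (b : ℂ) ≠ 0 := by exact_mod_cast hb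
  have hab' : (a : ℂ) + b ≠ 0 := by exact_mod_cast hab
  have ea' : (a : ℂ) ^ 2 = (k 0 : ℂ) ^ 2 + (k 1 : ℂ) ^ 2 := by exact_mod_cast ea
  have eb' : (b : ℂ) ^ 2 = (l 0 : ℂ) ^ 2 + (l 1 : ℂ) ^ 2 := by exact_mod_cast eb
  have en' : (n : ℂ) = ((k 0 : ℂ) + l 0) ^ 2 + ((k 1 : ℂ) + l 1) ^ 2 := by exact_mod_cast en
  push_cast
  generalize (a : ℂ) = a at *
  generalize (b : ℂ) = b at *
  generalize (n : ℂ) = n at *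
  generalize (k 0 : ℂ) = k0 at *
  generalize (k 1 : ℂ) = k1 at *
  generalize (l 0 : ℂ) = l0 at *
  generalize (l 1 : ℂ) = l1 at *
  have lhs : -n⁻¹ * (Complex.I * (k0 + l0) *
      (-(Complex.I * k1) / a * -a ^ 2 + -a ^ 2 * (-(Complex.I * l1) / b)) +
      Complex.I * (k1 + l1) * (Complex.I * k0 / a * -a ^ 2 + -a ^ 2 * (Complex.I * l0 / b))) =
      -(a / (b * n)) * (l1 * k0 - l0 * k1) * (b - a) := by
    field_simp
    linear_combination ((l1 * k0 - l0 * k1) * (b - a)) * hI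
  have rhs : 2 * ((k0 + l0) * (k0 + l0) / n * (1 / (a * b * (a + b)) * (a ^ 2 * k0 * l1))) +
      2 * ((k0 + l0) * (k1 + l1) / n * (1 / (a * b * (a + b)) * (a ^ 2 * k1 * l1))) +
      (-2 * ((k1 + l1) * (k0 + l0) / n * (1 / (a * b * (a + b)) * (a ^ 2 * k0 * l0))) +
      -2 * ((k1 + l1) * (k1 + l1) / n * (1 / (a * b * (a + b)) * (a ^ 2 * k1 * l0)))) +
      (1 / (a * b * (a + b)) * (a ^ 2 * k1 * l0) + -1 * (1 / (a * b * (a + b)) * (a ^ 2 * k0 * l1))) =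
      -(a / (b * n)) * (l1 * k0 - l0 * k1) * ((b ^ 2 - a ^ 2) / (a + b)) := by
    have h : b ^ 2 - a ^ 2 = n - 2 * ((k0 + l0) * k0 + (k1 + l1) * k1) := by
      rw [ea', eb', en']
      ring
    rw [h]
    field_simp
    ring
  rw [lhs, rhs]
  congr 1
  field_simp
  ring

lemma sC_zero {d : (Fin 2 → ℤ) → ℂ} (hc : RD c) (hd : RD d) : sC c d 0 = 0 := by
  have q := fun j i => (PolyB.qS j i).hasSum_Bil hc hd 0
  have h10 := (q 1 0).add ((q 0 1).mul_left (-1))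
  have : Bil (fun k l => (qS 1 0 k l : ℂ)) c d 0 + (-1) * Bil (fun k l => (qS 0 1 k l : ℂ)) c d 0
      = 0 := by
    refine h10.unique (hasSum_zero.congr_fun fun k => ?_)
    simp only [qS, zero_sub, Pi.neg_apply]
    push_cast
    ring
  simp only [sC, tK, nk_zero, this]
  simp

lemma Sbil_EE {d : (Fin 2 → ℤ) → ℂ} (hc : RD c) (hd : RD d) :
    Sbil (EE c) (EE d) = EE (sC c d) := by
  have hl := hc.lapK
  set v : Fin 2 → (Fin 2 → ℤ) → ℂ := fun i k =>
    Bil (fun _ _ => 1) (fun k => rS i k * lapK c k) d k +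
    Bil (fun _ _ => 1) (lapK c) (fun k => rS i k * d k) k with hv
  have rv : ∀ i, RD (v i) := fun i =>
    (RD.Bil PolyB.one (hl.rS i) hd).add (RD.Bil PolyB.one hl (hd.rS i))
  have e : (fun (y : Vd 2) (i : Fin 2) => sqgOp i (fun z => lapC (EE c) z) y * EE d y +
      sqgOp i (EE d) y * lapC (EE c) y) = fun y i => EE (v i) y := by
    funext y i
    have e0 : (fun z => lapC (EE c) z) = EE (lapK c) := lapC_EE hc
    rw [e0, lapC_EE hc, sqgOp_EE hl, sqgOp_EE hd, hv]
    rw [EE_add (RD.Bil PolyB.one (hl.rS i) hd) (RD.Bil PolyB.one hl (hd.rS i)),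
      EE_Bil_one (hl.rS i) hd, EE_Bil_one hl (hd.rS i)]
    ring
  unfold Sbil
  rw [e]
  have e1 : (fun x => divC (fun y i => EE (v i) y) x) = EE fun k => dC 0 (v 0) k + dC 1 (v 1) k :=
    divC_EE rv
  rw [e1, LapInv_EE (((rv 0).dC 0).add ((rv 1).dC 1))]
  congr 1
  funext m
  have q := fun j i => (PolyB.qS j i).hasSum_Bil hc hd m
  rcases eq_or_ne m 0 with rfl | hm
  · rw [sC_zero hc hd]
    simp [nk_zero]
  have p1 := fun i => (PolyB.one).hasSum_Bil (hl.rS i) hd m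
  have p2 := fun i => (PolyB.one).hasSum_Bil hl (hd.rS i) m
  have L := ((((p1 0).add (p2 0)).mul_left (Complex.I * (m 0 : ℂ))).add
    (((p1 1).add (p2 1)).mul_left (Complex.I * (m 1 : ℂ)))).mul_left (-((nk m : ℝ) : ℂ)⁻¹)
  have R := ((((q 0 1).mul_left ((m 0 * m 0 / nk m : ℝ) : ℂ)).mul_left 2).add
    (((q 1 1).mul_left ((m 0 * m 1 / nk m : ℝ) : ℂ)).mul_left 2)).add
    ((((q 0 0).mul_left ((m 1 * m 0 / nk m : ℝ) : ℂ)).mul_left (-2)).add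
    (((q 1 0).mul_left ((m 1 * m 1 / nk m : ℝ) : ℂ)).mul_left (-2))) |>.add
    ((q 1 0).add ((q 0 1).mul_left (-1)))
  refine L.unique (R.congr_fun fun k => ?_)
  have hs := symbol_identity k (m - k) (by simpa using hm)
  simp only [add_sub_cancel] at hs
  simp only [lapK]
  linear_combination (c k * d (m - k)) * hs

end

section

variable {c : (Fin 2 → ℤ) → ℂ}

/-- Iterated derivatives on coefficient sequences. -/
def dW : List (Fin 2) → ((Fin 2 → ℤ) → ℂ) → (Fin 2 → ℤ) → ℂ
  | [], c => c
  | p :: w, c => dW w (dC p c)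

lemma RD.dW (w : List (Fin 2)) (h : RD c) : RD (dW w c) := by
  induction w generalizing c with
  | nil => exact h
  | cons p w ih => exact ih (h.dC p)

lemma dC_dW (w : List (Fin 2)) (p : Fin 2) (c : (Fin 2 → ℤ) → ℂ) : dC p (dW w c) = dW (p :: w) c := by
  induction w generalizing c with
  | nil => rfl
  | cons q w ih =>
    change dC p (dW w (dC q c)) = dW w (dC q (dC p c))
    rw [ih, dC_comm q p]
    rfl

lemma dW_zero (w : List (Fin 2)) (hz : c 0 = 0) : dW w c 0 = 0 := by
  induction w generalizing c with
  | nil => exact hz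
  | cons p w ih => exact ih (by simp [dC])

lemma dW_add (w : List (Fin 2)) (c d : (Fin 2 → ℤ) → ℂ) :
    dW w (fun k => c k + d k) = fun k => dW w c k + dW w d k := by
  induction w generalizing c d with
  | nil => rfl
  | cons p w ih =>
    have : dC p (fun k => c k + d k) = fun k => dC p c k + dC p d k := by
      funext k; unfold dC; ring
    change dW w (dC p _) = _
    rw [this, ih]
    rfl

lemma holder_dW_sC {α K : ℝ} (w : List (Fin 2)) {d : (Fin 2 → ℤ) → ℂ} (hc : RD c) (hd : RD d)
    (H : ∀ w1 w2 : List (Fin 2), w1.length + w2.length = w.length →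
      HB α K (sC (dW w1 c) (dW w2 d))) :
    HB α (2 ^ w.length * K) (dW w (sC c d)) := by
  induction w generalizing c d with
  | nil => simpa [dW] using H [] [] rfl
  | cons p w ih =>
    change HB α _ (dW w (dC p (sC c d)))
    rw [dC_sC hc hd, dW_add]
    have h1 := ih (hc.dC p) hd fun w1 w2 h => H (p :: w1) w2 (by simp; omega)
    have h2 := ih hc (hd.dC p) fun w1 w2 h => H w1 (p :: w2) (by simp; omega)
    refine HB.mono (h1.add ((RD.sC (hc.dC p) hd).dW w) ((RD.sC hc (hd.dC p)).dW w) h2) (le_of_eq ?_)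
    rw [List.length_cons]
    ring

/-- The optimal Hölder constant for all derivatives of order `n`. -/
def hN (α : ℝ) (n : ℕ) (c : (Fin 2 → ℤ) → ℂ) : ℝ :=
  sInf {A | ∀ w : List (Fin 2), w.length = n → HB α A (dW w c)}

lemma hN_set_bdd (α : ℝ) (n : ℕ) (c : (Fin 2 → ℤ) → ℂ) :
    BddBelow {A | ∀ w : List (Fin 2), w.length = n → HB α A (dW w c)} :=
  ⟨0, fun _ hA => (hA (List.replicate n 0) (by simp)).nonneg⟩

lemma hN_set_nonempty {α : ℝ} (h0 : 0 ≤ α) (h1 : α ≤ 1) (h : RD c) (n : ℕ) :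
    {A | ∀ w : List (Fin 2), w.length = n → HB α A (dW w c)}.Nonempty := by
  induction n generalizing c with
  | zero =>
    obtain ⟨A, hA⟩ := exists_HB h0 h1 h
    refine ⟨A, fun w hw => ?_⟩
    obtain rfl := List.length_eq_zero_iff.1 hw
    exact hA
  | succ n ih =>
    obtain ⟨A, hA⟩ := ih (h.dC 0)
    obtain ⟨B, hB⟩ := ih (h.dC 1)
    refine ⟨max A B, fun w hw => ?_⟩
    match w, hw with
    | p :: w, hw =>
      have hw' : w.length = n := by simpa using hw
      fin_cases p
      · exact (hA w hw').mono (le_max_left _ _)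
      · exact (hB w hw').mono (le_max_right _ _)

lemma hN_le {α A : ℝ} {n : ℕ} (h : ∀ w : List (Fin 2), w.length = n → HB α A (dW w c)) :
    hN α n c ≤ A := csInf_le (hN_set_bdd α n c) h

lemma HB_hN {α : ℝ} (h0 : 0 ≤ α) (h1 : α ≤ 1) (h : RD c) (w : List (Fin 2)) :
    HB α (hN α w.length c) (dW w c) := by
  intro y x
  rcases eq_or_ne y 0 with rfl | hy
  · obtain ⟨A, hA⟩ := hN_set_nonempty h0 h1 h w.length
    rw [EE_shC (h.dW w)]
    simp only [add_zero, sub_self, norm_zero]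
    have : 0 ≤ hN α w.length c :=
      le_csInf ⟨A, hA⟩ fun A hA => (hA w rfl).nonneg
    positivity
  · have hp : 0 < ‖y‖ ^ α := Real.rpow_pos_of_pos (norm_pos_iff.2 hy) _
    rw [← div_le_iff₀ hp]
    refine le_csInf (hN_set_nonempty h0 h1 h w.length) fun A hA => ?_
    rw [div_le_iff₀ hp]
    exact hA w rfl y x

lemma hN_nonneg {α : ℝ} (h0 : 0 ≤ α) (h1 : α ≤ 1) (h : RD c) (n : ℕ) : 0 ≤ hN α n c := by
  have := (HB_hN h0 h1 h (List.replicate n 0)).nonneg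
  simpa using this

lemma hN_succ_le {α δ : ℝ} (h0 : 0 ≤ α) (h1 : α ≤ 1) (h : RD c) (n : ℕ) (hδ : 0 < δ) :
    hN α (n + 1) c ≤ hN α n c / δ + 2 * hN α (n + 2) c * δ := by
  refine hN_le fun w hw => ?_
  match w, hw with
  | p :: w, hw =>
    have hw' : w.length = n := by simpa using hw
    intro y x
    rw [← dC_dW, shC_dC]
    have hr := (h.dW w).shC y
    have hA : ∀ x, ‖EE (shC y (dW w c)) x‖ ≤ hN α n c * ‖y‖ ^ α := fun x => by
      rw [← hw']
      exact HB_hN h0 h1 h w y x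
    have hB : ∀ i x, ‖EE (dC i (dC i (shC y (dW w c)))) x‖ ≤ hN α (n + 2) c * ‖y‖ ^ α := fun i x => by
      rw [← shC_dC, ← shC_dC, dC_dW, dC_dW, ← hw']
      exact HB_hN h0 h1 h (i :: i :: w) y x
    refine (norm_dC_le hr p (M := 2 * (hN α n c * ‖y‖ ^ α)) (L := 2 * (hN α (n + 2) c * ‖y‖ ^ α)) hδ
      (fun z s _ _ => ?_) (fun z => ?_) x).trans (le_of_eq ?_)
    · exact (norm_sub_le _ _).trans (by linarith [hA (z + s • ei p), hA (z + (-s) • ei p)])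
    · rw [EE_lapK hr]
      exact (norm_add_le _ _).trans (by linarith [hB 0 z, hB 1 z])
    · field_simp

lemma sq_hN_le {α : ℝ} (h0 : 0 ≤ α) (h1 : α ≤ 1) (h : RD c) (n : ℕ) :
    hN α (n + 1) c ^ 2 ≤ 8 * (hN α n c * hN α (n + 2) c) := by
  have a0 := hN_nonneg h0 h1 h n
  have a1 := hN_nonneg h0 h1 h (n + 1)
  have a2 := hN_nonneg h0 h1 h (n + 2)
  have key : ∀ δ : ℝ, 0 ≤ 2 * hN α (n + 2) c * (δ * δ) + (-hN α (n + 1) c) * δ + hN α n c := by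
    intro δ
    rcases le_or_gt δ 0 with hδ | hδ
    · have := mul_nonneg a1 (neg_nonneg.2 hδ)
      have := mul_nonneg a2 (mul_self_nonneg δ)
      linarith
    · have h := hN_succ_le h0 h1 h n hδ
      have h' := mul_le_mul_of_nonneg_right h hδ.le
      have e : (hN α n c / δ + 2 * hN α (n + 2) c * δ) * δ
          = hN α n c + 2 * hN α (n + 2) c * (δ * δ) := by
        field_simp
      rw [e] at h'
      linarith
  have := discrim_le_zero key
  unfold discrim at this
  linarith

lemma interp_endpoints {x : ℕ → ℝ} {N : ℕ} (hx : ∀ j, 0 ≤ x j)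
    (h : ∀ j, j + 2 ≤ N → x (j + 1) ^ 2 ≤ 64 * (x j * x (j + 2))) {j : ℕ} (hj : j ≤ N) :
    x j ≤ 16 ^ N ^ 2 * (x 0 + x N) := by
  set y : ℕ → ℝ := fun j => x j * 16 ^ j ^ 2 with hy
  obtain ⟨m, hm, hmax⟩ := Finset.exists_max_image (Finset.range (N + 1)) y ⟨0, by simp⟩
  have hmN : m ≤ N := by simpa [Nat.lt_succ_iff] using hm
  have hy0 : ∀ j, 0 ≤ y j := fun j => mul_nonneg (hx j) (by positivity)
  have hle : ∀ j, x j ≤ y j := fun j => le_mul_of_one_le_right (hx j) (one_le_pow₀ (by norm_num))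
  have h1 : (1 : ℝ) ≤ 16 ^ N ^ 2 := one_le_pow₀ (by norm_num)
  have goal : y m ≤ 16 ^ N ^ 2 * (x 0 + x N) := by
    by_cases hm0 : m = 0
    · subst hm0
      have e : y 0 = x 0 := by simp [hy]
      rw [e]
      nlinarith [hx 0, hx N]
    by_cases hmN' : m = N
    · subst hmN'
      simp only [hy]
      nlinarith [hx 0, hx m]
    obtain ⟨i, rfl⟩ := Nat.exists_eq_succ_of_ne_zero hm0
    have hi : i + 2 ≤ N := by omega
    have ha := hmax i (by simp; omega)
    have hb := hmax (i + 2) (by simp; omega)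
    have hsq : 4 * y (i + 1) ^ 2 ≤ y i * y (i + 2) := by
      have e1 : 4 * y (i + 1) ^ 2 = 4 * 16 ^ (2 * (i + 1) ^ 2) * x (i + 1) ^ 2 := by
        simp only [hy]; ring
      have e2 : y i * y (i + 2) = 4 * 16 ^ (2 * (i + 1) ^ 2) * (64 * (x i * x (i + 2))) := by
        simp only [hy]
        have : x i * 16 ^ i ^ 2 * (x (i + 2) * 16 ^ (i + 2) ^ 2) =
          x i * x (i + 2) * 16 ^ (i ^ 2 + (i + 2) ^ 2) := by rw [pow_add]; ring
        rw [this, show i ^ 2 + (i + 2) ^ 2 = 2 * (i + 1) ^ 2 + 2 by ring, pow_add]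
        ring
      rw [e1, e2]
      exact mul_le_mul_of_nonneg_left (h i hi) (by positivity)
    have hub : y i * y (i + 2) ≤ y (i + 1) * y (i + 1) :=
      mul_le_mul ha hb (hy0 _) (hy0 _)
    have hz : y (i + 1) = 0 := by
      have : y (i + 1) ^ 2 ≤ 0 := by nlinarith [sq_nonneg (y (i + 1))]
      exact pow_eq_zero_iff two_ne_zero |>.1 (le_antisymm this (sq_nonneg _))
    change y (i + 1) ≤ _
    rw [hz]
    have := hx 0
    have := hx N
    positivity
  exact (hle j).trans ((hmax j (by simp; omega)).trans goal)

lemma holder_dW_sC_le {α : ℝ} (h0 : 0 < α) (h1 : α < 1) {d : (Fin 2 → ℤ) → ℂ} (hc : RD c) (hd : RD d)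
    (hd0 : d 0 = 0) (w : List (Fin 2)) :
    HB α (2 ^ w.length * (kS α * (16 ^ w.length ^ 2 *
      (hN α 1 c * hN α w.length d + hN α (w.length + 1) c * hN α 0 d)))) (dW w (sC c d)) := by
  refine holder_dW_sC w hc hd fun w1 w2 hw => ?_
  have hk : 0 ≤ kS α := by
    have := kA_pos h0 h1
    unfold kS
    positivity
  have base := holder_sC (A := hN α (w1.length + 1) c) (B := hN α w2.length d) h0 h1 (hc.dW w1)
    (hd.dW w2) (dW_zero w2 hd0) (fun j => ?_) (HB_hN h0.le h1.le hd w2)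
  · refine base.mono (mul_le_mul_of_nonneg_left ?_ hk)
    have := interp_endpoints (x := fun j => hN α (j + 1) c * hN α (w.length - j) d) (N := w.length)
      (fun j => mul_nonneg (hN_nonneg h0.le h1.le hc _) (hN_nonneg h0.le h1.le hd _)) ?_
      (j := w1.length) (by omega)
    · have e : w.length - w1.length = w2.length := by omega
      simpa [e] using this
    · intro j hj
      obtain ⟨n, hn⟩ : ∃ n, w.length = j + 2 + n := ⟨w.length - (j + 2), by omega⟩
      have i1 := sq_hN_le h0.le h1.le hc (j + 1)
      have i2 := sq_hN_le h0.le h1.le hd n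
      rw [show w.length - (j + 1) = n + 1 by omega, show w.length - j = n + 2 by omega,
        show w.length - (j + 2) = n by omega, mul_pow]
      refine (mul_le_mul i1 i2 (sq_nonneg _) ((sq_nonneg _).trans i1)).trans (le_of_eq ?_)
      ring
  · rw [dC_dW]
    exact HB_hN h0.le h1.le hc (j :: w1)

end

section

variable {c : (Fin 2 → ℤ) → ℂ}

lemma iteratedFDeriv_EE (h : RD c) (n : ℕ) (w : Fin n → Fin 2) (x : Vd 2) :
    iteratedFDeriv ℝ n (EE c) x (fun i => ei (w i)) = EE (dW (List.ofFn w) c) x := by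
  induction n generalizing x with
  | zero => simp [dW]
  | succ n ih =>
    rw [iteratedFDeriv_succ_apply_left]
    have hd : DifferentiableAt ℝ (iteratedFDeriv ℝ n (EE c)) x :=
      ((contDiff_EE h (n + 1)).differentiable_iteratedFDeriv (by exact_mod_cast n.lt_succ_self)) x
    have e := fderiv_continuousMultilinear_apply_const hd (Fin.tail fun i => ei (w i))
    have e' : (fun y => iteratedFDeriv ℝ n (EE c) y (Fin.tail fun i => ei (w i)))
        = EE (dW (List.ofFn (Fin.tail w)) c) := by
      funext y
      exact ih (Fin.tail w) y
    rw [e'] at e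
    have e2 := congrArg (fun L => L (ei (w 0))) e
    simp only [ContinuousLinearMap.flipMultilinear_apply_apply] at e2
    rw [← e2]
    have := congrFun (pd_EE (h.dW (List.ofFn (Fin.tail w))) (w 0)) x
    unfold pd at this
    unfold ei
    rw [this, dC_dW, List.ofFn_succ]
    rfl

lemma sum_smul_ei (v : Vd 2) : ∑ j, v j • ei j = v := by
  funext i
  fin_cases i <;> simp [ei, Fin.sum_univ_two]

lemma norm_multilinear_le {F : Type*} [NormedAddCommGroup F] [NormedSpace ℝ F] {n : ℕ} {A : ℝ}
    (T : ContinuousMultilinearMap ℝ (fun _ : Fin n => Vd 2) F)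
    (hT : ∀ w : Fin n → Fin 2, ‖T fun i => ei (w i)‖ ≤ A) : ‖T‖ ≤ 2 ^ n * A := by
  have hA : 0 ≤ A := (norm_nonneg _).trans (hT fun _ => 0)
  refine T.opNorm_le_bound (by positivity) fun m => ?_
  have e : T m = ∑ w : Fin n → Fin 2, (∏ i, m i (w i)) • T fun i => ei (w i) := by
    conv_lhs => rw [show m = fun i => ∑ j, m i j • ei j from funext fun i => (sum_smul_ei (m i)).symm]
    rw [T.map_sum]
    refine Finset.sum_congr rfl fun w _ => ?_
    exact T.map_smul_univ (fun i => m i (w i)) (fun i => ei (w i))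
  rw [e]
  refine (norm_sum_le _ _).trans ?_
  have : ∀ w ∈ (Finset.univ : Finset (Fin n → Fin 2)),
      ‖(∏ i, m i (w i)) • T fun i => ei (w i)‖ ≤ A * ∏ i, ‖m i‖ := by
    intro w _
    rw [norm_smul, norm_prod, mul_comm]
    refine mul_le_mul (hT w) (Finset.prod_le_prod (fun _ _ => norm_nonneg _) fun i _ => ?_)
      (by positivity) hA
    exact norm_le_pi_norm (m i) (w i)
  refine (Finset.sum_le_sum this).trans (le_of_eq ?_)
  simp
  ring

lemma sup_dW_le {α A : ℝ} (h0 : 0 ≤ α) (h1 : α ≤ 1) (h : RD c) (hz : c 0 = 0) {N : ℕ}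
    (hA : ∀ w : List (Fin 2), w.length = N → HB α A (dW w c)) (r : ℕ) (w : List (Fin 2))
    (hw : w.length + r = N) (x : Vd 2) : ‖EE (dW w c) x‖ ≤ 14 ^ r * (7 * A) := by
  induction r generalizing w x with
  | zero =>
    simpa using HB.sup_le h0 h1 (hA w hw) (h.dW w) (dW_zero w hz) x
  | succ r ih =>
    refine (sup_le_grad (h.dW w) (dW_zero w hz) (G := 14 ^ r * (7 * A)) (fun i x => ?_) x).trans
      (le_of_eq (by ring))
    rw [dC_dW]
    exact ih (i :: w) (by simp; omega) x

lemma iteratedFDeriv_EE_sub_le {α A : ℝ} (h : RD c) {n : ℕ}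
    (hA : ∀ w : List (Fin 2), w.length = n → HB α A (dW w c)) (p q : Vd 2) :
    ‖iteratedFDeriv ℝ n (EE c) p - iteratedFDeriv ℝ n (EE c) q‖ ≤ 2 ^ n * (A * ‖p - q‖ ^ α) := by
  refine norm_multilinear_le _ fun w => ?_
  rw [_root_.sub_apply, iteratedFDeriv_EE h, iteratedFDeriv_EE h]
  have := hA (List.ofFn w) (by simp) (p - q) q
  rwa [EE_shC (h.dW _), add_sub_cancel] at this

lemma HolNorm_EE_le {α A : ℝ} (h0 : 0 ≤ α) (h1 : α ≤ 1) (h : RD c) (hz : c 0 = 0) {N : ℕ}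
    (hA : ∀ w : List (Fin 2), w.length = N → HB α A (dW w c)) :
    HolNorm N α (EE c) ≤ ((N + 1) * (2 ^ N * (14 ^ N * 7)) + 2 ^ N) * A := by
  have hA0 : 0 ≤ A := (hA (List.replicate N 0) (by simp)).nonneg
  have hC : CkNorm N (EE c) ≤ (N + 1) * (2 ^ N * (14 ^ N * 7)) * A := by
    unfold CkNorm
    have : ∀ n ∈ Finset.range (N + 1), (⨆ x : Vd 2, ‖iteratedFDeriv ℝ n (EE c) x‖)
        ≤ 2 ^ N * (14 ^ N * 7) * A := by
      intro n hn
      have hn' : n ≤ N := by simpa [Nat.lt_succ_iff] using hn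
      refine ciSup_le fun x => ?_
      refine (norm_multilinear_le (A := 14 ^ N * (7 * A)) _ fun w => ?_).trans ?_
      · rw [iteratedFDeriv_EE h]
        refine (sup_dW_le h0 h1 h hz hA (N - n) (List.ofFn w) (by simp; omega) x).trans ?_
        gcongr
        · norm_num
        · omega
      · rw [show (2 : ℝ) ^ N * (14 ^ N * 7) * A = 2 ^ N * (14 ^ N * (7 * A)) by ring]
        gcongr
        norm_num
    refine (Finset.sum_le_sum this).trans (le_of_eq ?_)
    simp
    ring
  have hH : hSemi α (iteratedFDeriv ℝ N (EE c)) ≤ 2 ^ N * A := by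
    unfold hSemi
    refine ciSup_le fun p => ?_
    split_ifs with hp
    · positivity
    · have hpos : 0 < ‖p.1 - p.2‖ ^ α :=
        Real.rpow_pos_of_pos (norm_pos_iff.2 (sub_ne_zero.2 hp)) _
      rw [div_le_iff₀ hpos, mul_assoc]
      exact iteratedFDeriv_EE_sub_le h hA p.1 p.2
  unfold HolNorm
  linarith

section
variable {f : Vd 2 → ℝ}

lemma contDiff_cplx (hf : ContDiff ℝ (⊤ : ℕ∞) f) : ContDiff ℝ (⊤ : ℕ∞) (cplx f) :=
  Complex.ofRealCLM.contDiff.comp hf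

lemma torusFun_cplx (hp : TorusFun f) : TorusFun (cplx f) := fun x m => by
  unfold cplx
  rw [hp]

lemma fCoeff_cplx_zero (hz : MeanZeroR f) : fCoeff (cplx f) 0 = 0 := by
  have : ∫ x in box 2, ((f x : ℝ) : ℂ) = 0 := by
    rw [integral_complex_ofReal, hz]
    simp
  unfold fCoeff cplx dotZ
  simp [this]

lemma iteratedFDeriv_cplx (hf : ContDiff ℝ (⊤ : ℕ∞) f) (n : ℕ) (x : Vd 2) (v : Fin n → Vd 2) :
    iteratedFDeriv ℝ n (cplx f) x v = ((iteratedFDeriv ℝ n f x v : ℝ) : ℂ) := by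
  have := Complex.ofRealCLM.iteratedFDeriv_comp_left (f := f) (x := x) (n := (⊤ : ℕ∞)) (i := n)
    hf.contDiffAt (by exact_mod_cast le_top)
  change iteratedFDeriv ℝ n (Complex.ofRealCLM ∘ f) x v = _
  rw [this]
  rfl

lemma hN_le_hSemi {α : ℝ} (h0 : 0 ≤ α) (h1 : α ≤ 1) (hf : ContDiff ℝ (⊤ : ℕ∞) f) (hp : TorusFun f)
    (n : ℕ) : hN α n (fCoeff (cplx f)) ≤ hSemi α (iteratedFDeriv ℝ n f) := by
  have hr := RD_fCoeff (contDiff_cplx hf) (torusFun_cplx hp)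
  have he := EE_fCoeff (contDiff_cplx hf) (torusFun_cplx hp)
  set c := fCoeff (cplx f)
  have key : ∀ (w : Fin n → Fin 2) (x : Vd 2),
      EE (dW (List.ofFn w) c) x = ((iteratedFDeriv ℝ n f x (fun i => ei (w i)) : ℝ) : ℂ) := by
    intro w x
    rw [← iteratedFDeriv_EE hr, he, iteratedFDeriv_cplx hf]
  obtain ⟨A, hA⟩ := hN_set_nonempty h0 h1 hr n
  have hA0 : 0 ≤ A := (hA (List.replicate n 0) (by simp)).nonneg
  have hb : BddAbove (Set.range fun p : Vd 2 × Vd 2 => if p.1 = p.2 then 0 else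
      ‖iteratedFDeriv ℝ n f p.1 - iteratedFDeriv ℝ n f p.2‖ / ‖p.1 - p.2‖ ^ α) := by
    refine ⟨2 ^ n * A, ?_⟩
    rintro _ ⟨p, rfl⟩
    beta_reduce
    split_ifs with hpq
    · positivity
    · have hpos : 0 < ‖p.1 - p.2‖ ^ α :=
        Real.rpow_pos_of_pos (norm_pos_iff.2 (sub_ne_zero.2 hpq)) _
      rw [div_le_iff₀ hpos, mul_assoc]
      refine norm_multilinear_le _ fun w => ?_
      rw [_root_.sub_apply, ← Complex.norm_real, Complex.ofReal_sub, ← key, ← key]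
      have := hA (List.ofFn w) (by simp) (p.1 - p.2) p.2
      rwa [EE_shC (hr.dW _), add_sub_cancel] at this
  refine hN_le fun w hw => ?_
  subst hw
  intro y x
  rw [EE_shC (hr.dW w)]
  rcases eq_or_ne y 0 with rfl | hy
  · simp only [add_zero, sub_self, norm_zero]
    refine mul_nonneg (Real.iSup_nonneg fun p => ?_) (by positivity)
    split_ifs <;> positivity
  have hpos : 0 < ‖y‖ ^ α := Real.rpow_pos_of_pos (norm_pos_iff.2 hy) _
  have hw : List.ofFn w.get = w := List.ofFn_get w
  have k := key w.get
  rw [hw] at k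
  rw [k, k, ← Complex.ofReal_sub, Complex.norm_real, ← _root_.sub_apply]
  refine (ContinuousMultilinearMap.le_opNorm _ _).trans ?_
  simp only [norm_ei, Finset.prod_const_one, mul_one]
  have := le_ciSup hb (x + y, x)
  have hne : x + y ≠ x := by simpa using hy
  simp only [hne, if_false, add_sub_cancel_left] at this
  rwa [div_le_iff₀ hpos] at this

lemma hN_le_HolNorm {α : ℝ} (h0 : 0 ≤ α) (h1 : α ≤ 1) (hf : ContDiff ℝ (⊤ : ℕ∞) f) (hp : TorusFun f)
    (n : ℕ) : hN α n (fCoeff (cplx f)) ≤ HolNorm n α f := by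
  refine (hN_le_hSemi h0 h1 hf hp n).trans ?_
  unfold HolNorm CkNorm
  refine le_add_of_nonneg_left (Finset.sum_nonneg fun i _ => Real.iSup_nonneg fun x => norm_nonneg _)

end

end

/-- Hölder estimate for `S[f,g] = Δ^{-1} div(𝒯[Δf]g + 𝒯[g]Δf)`:
`‖S[f,g]‖_{N+α} ≲ ‖f‖_{N+1+α}‖g‖_α + ‖f‖_{1+α}‖g‖_{N+α}`. -/
theorem bilinear_S_holder_estimate (α : ℝ) (hα0 : 0 < α) (hα1 : α < 1) (N : ℕ) :
    ∃ C > 0, ∀ f g : Vd 2 → ℝ,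
      ContDiff ℝ (⊤ : ℕ∞) f → ContDiff ℝ (⊤ : ℕ∞) g → TorusFun f → TorusFun g →
      MeanZeroR f → MeanZeroR g →
      HolNorm N α (Sbil (cplx f) (cplx g)) ≤
        C * (HolNorm (N+1) α f * HolNorm 0 α g + HolNorm 1 α f * HolNorm N α g) := by
  have hk : 0 < kS α := by
    have := kA_pos hα0 hα1
    unfold kS
    positivity
  refine ⟨((N + 1) * (2 ^ N * (14 ^ N * 7)) + 2 ^ N) * (2 ^ N * (kS α * 16 ^ N ^ 2)), by positivity, ?_⟩
  intro f g hf hg pf pg _ zg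
  have rf := RD_fCoeff (contDiff_cplx hf) (torusFun_cplx pf)
  have rg := RD_fCoeff (contDiff_cplx hg) (torusFun_cplx pg)
  have hgz := fCoeff_cplx_zero zg
  rw [← EE_fCoeff (contDiff_cplx hf) (torusFun_cplx pf),
    ← EE_fCoeff (contDiff_cplx hg) (torusFun_cplx pg), Sbil_EE rf rg]
  have main := HolNorm_EE_le hα0.le hα1.le (RD.sC rf rg) (sC_zero rf rg) (N := N) (α := α)
    (fun w hw => hw ▸ holder_dW_sC_le hα0 hα1 rf rg hgz w)
  refine main.trans ?_
  have f1 := hN_le_HolNorm hα0.le hα1.le hf pf 1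
  have fN := hN_le_HolNorm hα0.le hα1.le hf pf (N + 1)
  have g0 := hN_le_HolNorm hα0.le hα1.le hg pg 0
  have gN := hN_le_HolNorm hα0.le hα1.le hg pg N
  have f1' := hN_nonneg hα0.le hα1.le rf 1
  have fN' := hN_nonneg hα0.le hα1.le rf (N + 1)
  have g0' := hN_nonneg hα0.le hα1.le rg 0
  have gN' := hN_nonneg hα0.le hα1.le rg N
  have m1 := mul_le_mul f1 gN gN' (f1'.trans f1)
  have m2 := mul_le_mul fN g0 g0' (fN'.trans fN)
  rw [mul_assoc, mul_assoc (2 ^ N : ℝ), mul_assoc (kS α)]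
  gcongr ?_ * (?_ * (?_ * (?_ * ?_)))
  linarith
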